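/- arXiv:2402.08822 — 11 statements merged into one kernel-verified Lean document; each statement's English description precedes it below -/
import Mathlib

section
/- Let u : ℝ³ → ℝ be a smooth solution of the fine Kolmogorov backward equation on an open set Ω ⊆ ℝ³. Then each of the following functions is again a solution of the fine Kolmogorov backward equation on Ω: (i) (t,x,y) ↦ ∂u/∂y(t,x,y); (ii) (t,x,y) ↦ x·∂u/∂x(t,x,y) + y·∂u/∂y(t,x,y); (iii) (t,x,y) ↦ 2xy·∂u/∂x(t,x,y) + y²·∂u/∂y(t,x,y) + x·u(t,x,y); (iv) (t,x,y) ↦ ∂u/∂t(t,x,y). (These are the actions of the Lie-symmetry operators P^y = D_y, D = xD_x + yD_y, K = 2xyD_x + y²D_y + x and P^t = D_t, which are recursion operators of the equation.) -/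
open Real Set

/-- Partial derivative with respect to the first (time) variable. -/
noncomputable def pdt (u : ℝ × ℝ × ℝ → ℝ) (p : ℝ × ℝ × ℝ) : ℝ :=
  deriv (fun s => u (s, p.2.1, p.2.2)) p.1

/-- Partial derivative with respect to the second (space, `x`) variable. -/
noncomputable def pdx (u : ℝ × ℝ × ℝ → ℝ) (p : ℝ × ℝ × ℝ) : ℝ :=
  deriv (fun s => u (p.1, s, p.2.2)) p.2.1

/-- Partial derivative with respect to the third (`y`) variable. -/
noncomputable def pdy (u : ℝ × ℝ × ℝ → ℝ) (p : ℝ × ℝ × ℝ) : ℝ :=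
  deriv (fun s => u (p.1, p.2.1, s)) p.2.2

/-- Second partial derivative with respect to `x`. -/
noncomputable def pdxx (u : ℝ × ℝ × ℝ → ℝ) (p : ℝ × ℝ × ℝ) : ℝ :=
  deriv (fun s => deriv (fun r => u (p.1, r, p.2.2)) s) p.2.1

/-- `u` is a (smooth) solution of the fine Kolmogorov backward equation
`u_t + x u_y = x² u_xx` on the set `Ω`. -/
def IsSolutionOn (u : ℝ × ℝ × ℝ → ℝ) (Ω : Set (ℝ × ℝ × ℝ)) : Prop :=
  ContDiffOn ℝ (⊤ : ℕ∞) u Ω ∧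
    ∀ p ∈ Ω, pdt u p + p.2.1 * pdy u p = p.2.1 ^ 2 * pdxx u p

open scoped ContDiff

/-- A function which is differentiable at `c s` has the expected derivative along the curve `c`. -/
lemma hasDerivAt_comp_curve {f : ℝ × ℝ × ℝ → ℝ} {c : ℝ → ℝ × ℝ × ℝ} {v : ℝ × ℝ × ℝ} {s : ℝ}
    (hf : DifferentiableAt ℝ f (c s)) (hc : HasDerivAt c v s) :
    HasDerivAt (fun r => f (c r)) (fderiv ℝ f (c s) v) s :=
  hf.hasFDerivAt.comp_hasDerivAt s hc

lemma hasDerivAt_slice_t {f : ℝ × ℝ × ℝ → ℝ} {t x y : ℝ} (hf : DifferentiableAt ℝ f (t, x, y)) :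
    HasDerivAt (fun s => f (s, x, y)) (fderiv ℝ f (t, x, y) (1, 0, 0)) t :=
  hasDerivAt_comp_curve (c := fun s => (s, x, y)) hf
    ((hasDerivAt_id t).prodMk ((hasDerivAt_const t x).prodMk (hasDerivAt_const t y)))

lemma hasDerivAt_slice_x {f : ℝ × ℝ × ℝ → ℝ} {t x y : ℝ} (hf : DifferentiableAt ℝ f (t, x, y)) :
    HasDerivAt (fun s => f (t, s, y)) (fderiv ℝ f (t, x, y) (0, 1, 0)) x :=
  hasDerivAt_comp_curve (c := fun s => (t, s, y)) hf
    ((hasDerivAt_const x t).prodMk ((hasDerivAt_id x).prodMk (hasDerivAt_const x y)))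

lemma hasDerivAt_slice_y {f : ℝ × ℝ × ℝ → ℝ} {t x y : ℝ} (hf : DifferentiableAt ℝ f (t, x, y)) :
    HasDerivAt (fun s => f (t, x, s)) (fderiv ℝ f (t, x, y) (0, 0, 1)) y :=
  hasDerivAt_comp_curve (c := fun s => (t, x, s)) hf
    ((hasDerivAt_const y t).prodMk ((hasDerivAt_const y x).prodMk (hasDerivAt_id y)))

section Partial

variable {Ω : Set (ℝ × ℝ × ℝ)} {f g : ℝ × ℝ × ℝ → ℝ} {p : ℝ × ℝ × ℝ} {t x y : ℝ}

lemma pdxx_eq_pdx_pdx (f : ℝ × ℝ × ℝ → ℝ) : pdxx f = pdx (pdx f) := rfl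

lemma differentiableAt_of_smoothOn (hΩ : IsOpen Ω) (hf : ContDiffOn ℝ ∞ f Ω) (hp : p ∈ Ω) :
    DifferentiableAt ℝ f p :=
  (hf.contDiffAt (hΩ.mem_nhds hp)).differentiableAt (by simp)

lemma contDiffOn_fderiv_apply (hΩ : IsOpen Ω) (hf : ContDiffOn ℝ ∞ f Ω) (v : ℝ × ℝ × ℝ) :
    ContDiffOn ℝ ∞ (fun q => fderiv ℝ f q v) Ω :=
  (hf.fderiv_of_isOpen hΩ (by simp)).clm_apply contDiffOn_const

lemma fderiv_fderiv_apply_comm (hΩ : IsOpen Ω) (hf : ContDiffOn ℝ ∞ f Ω) (hp : p ∈ Ω)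
    (v w : ℝ × ℝ × ℝ) :
    fderiv ℝ (fun q => fderiv ℝ f q v) p w = fderiv ℝ (fun q => fderiv ℝ f q w) p v := by
  have hd : DifferentiableAt ℝ (fderiv ℝ f) p :=
    ((hf.fderiv_of_isOpen hΩ (m := ∞) (by simp)).contDiffAt (hΩ.mem_nhds hp)).differentiableAt
      (by simp)
  have hs : IsSymmSndFDerivAt ℝ f p :=
    (hf.contDiffAt (hΩ.mem_nhds hp)).isSymmSndFDerivAt
      (by simp only [minSmoothness_of_isRCLikeNormedField]; exact WithTop.coe_le_coe.2 le_top)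
  rw [fderiv_clm_apply hd (differentiableAt_const v),
    fderiv_clm_apply hd (differentiableAt_const w)]
  simpa using hs w v

lemma Set.EqOn.fderiv_of_isOpen (hΩ : IsOpen Ω) (h : EqOn f g Ω) (hp : p ∈ Ω) :
    fderiv ℝ f p = fderiv ℝ g p :=
  (h.eventuallyEq_of_mem (hΩ.mem_nhds hp)).fderiv_eq

lemma eqOn_pdt_fderiv (hΩ : IsOpen Ω) (hf : ContDiffOn ℝ ∞ f Ω) :
    EqOn (pdt f) (fun q => fderiv ℝ f q (1, 0, 0)) Ω :=
  fun _ hq => (hasDerivAt_slice_t (differentiableAt_of_smoothOn hΩ hf hq)).deriv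

lemma ContDiffOn.pdt (hΩ : IsOpen Ω) (hf : ContDiffOn ℝ ∞ f Ω) : ContDiffOn ℝ ∞ (pdt f) Ω :=
  (contDiffOn_fderiv_apply hΩ hf _).congr (eqOn_pdt_fderiv hΩ hf)

lemma hasDerivAt_pdt (hΩ : IsOpen Ω) (hf : ContDiffOn ℝ ∞ f Ω) (hp : (t, x, y) ∈ Ω) :
    HasDerivAt (fun s => f (s, x, y)) (pdt f (t, x, y)) t :=
  (hasDerivAt_slice_t (differentiableAt_of_smoothOn hΩ hf hp)).differentiableAt.hasDerivAt

lemma Set.EqOn.pdt (hΩ : IsOpen Ω) (hf : ContDiffOn ℝ ∞ f Ω) (h : EqOn f g Ω) :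
    EqOn (pdt f) (pdt g) Ω := fun q hq => by
  rw [eqOn_pdt_fderiv hΩ hf hq, eqOn_pdt_fderiv hΩ (hf.congr h.symm) hq]
  simp only [h.fderiv_of_isOpen hΩ hq]

lemma eqOn_pdx_fderiv (hΩ : IsOpen Ω) (hf : ContDiffOn ℝ ∞ f Ω) :
    EqOn (pdx f) (fun q => fderiv ℝ f q (0, 1, 0)) Ω :=
  fun _ hq => (hasDerivAt_slice_x (differentiableAt_of_smoothOn hΩ hf hq)).deriv

lemma ContDiffOn.pdx (hΩ : IsOpen Ω) (hf : ContDiffOn ℝ ∞ f Ω) : ContDiffOn ℝ ∞ (pdx f) Ω :=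
  (contDiffOn_fderiv_apply hΩ hf _).congr (eqOn_pdx_fderiv hΩ hf)

lemma hasDerivAt_pdx (hΩ : IsOpen Ω) (hf : ContDiffOn ℝ ∞ f Ω) (hp : (t, x, y) ∈ Ω) :
    HasDerivAt (fun s => f (t, s, y)) (pdx f (t, x, y)) x :=
  (hasDerivAt_slice_x (differentiableAt_of_smoothOn hΩ hf hp)).differentiableAt.hasDerivAt

lemma Set.EqOn.pdx (hΩ : IsOpen Ω) (hf : ContDiffOn ℝ ∞ f Ω) (h : EqOn f g Ω) :
    EqOn (pdx f) (pdx g) Ω := fun q hq => by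
  rw [eqOn_pdx_fderiv hΩ hf hq, eqOn_pdx_fderiv hΩ (hf.congr h.symm) hq]
  simp only [h.fderiv_of_isOpen hΩ hq]

lemma eqOn_pdy_fderiv (hΩ : IsOpen Ω) (hf : ContDiffOn ℝ ∞ f Ω) :
    EqOn (pdy f) (fun q => fderiv ℝ f q (0, 0, 1)) Ω :=
  fun _ hq => (hasDerivAt_slice_y (differentiableAt_of_smoothOn hΩ hf hq)).deriv

lemma ContDiffOn.pdy (hΩ : IsOpen Ω) (hf : ContDiffOn ℝ ∞ f Ω) : ContDiffOn ℝ ∞ (pdy f) Ω :=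
  (contDiffOn_fderiv_apply hΩ hf _).congr (eqOn_pdy_fderiv hΩ hf)

lemma hasDerivAt_pdy (hΩ : IsOpen Ω) (hf : ContDiffOn ℝ ∞ f Ω) (hp : (t, x, y) ∈ Ω) :
    HasDerivAt (fun s => f (t, x, s)) (pdy f (t, x, y)) y :=
  (hasDerivAt_slice_y (differentiableAt_of_smoothOn hΩ hf hp)).differentiableAt.hasDerivAt

lemma Set.EqOn.pdy (hΩ : IsOpen Ω) (hf : ContDiffOn ℝ ∞ f Ω) (h : EqOn f g Ω) :
    EqOn (pdy f) (pdy g) Ω := fun q hq => by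
  rw [eqOn_pdy_fderiv hΩ hf hq, eqOn_pdy_fderiv hΩ (hf.congr h.symm) hq]
  simp only [h.fderiv_of_isOpen hΩ hq]

lemma eqOn_pdt_pdx (hΩ : IsOpen Ω) (hf : ContDiffOn ℝ ∞ f Ω) :
    EqOn (pdt (pdx f)) (pdx (pdt f)) Ω := fun q hq => by
  rw [eqOn_pdt_fderiv hΩ (hf.pdx hΩ) hq, eqOn_pdx_fderiv hΩ (hf.pdt hΩ) hq]
  simp only [(eqOn_pdt_fderiv hΩ hf).fderiv_of_isOpen hΩ hq,
    (eqOn_pdx_fderiv hΩ hf).fderiv_of_isOpen hΩ hq]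
  exact fderiv_fderiv_apply_comm hΩ hf hq _ _

lemma eqOn_pdt_pdy (hΩ : IsOpen Ω) (hf : ContDiffOn ℝ ∞ f Ω) :
    EqOn (pdt (pdy f)) (pdy (pdt f)) Ω := fun q hq => by
  rw [eqOn_pdt_fderiv hΩ (hf.pdy hΩ) hq, eqOn_pdy_fderiv hΩ (hf.pdt hΩ) hq]
  simp only [(eqOn_pdt_fderiv hΩ hf).fderiv_of_isOpen hΩ hq,
    (eqOn_pdy_fderiv hΩ hf).fderiv_of_isOpen hΩ hq]
  exact fderiv_fderiv_apply_comm hΩ hf hq _ _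

lemma eqOn_pdy_pdx (hΩ : IsOpen Ω) (hf : ContDiffOn ℝ ∞ f Ω) :
    EqOn (pdy (pdx f)) (pdx (pdy f)) Ω := fun q hq => by
  rw [eqOn_pdy_fderiv hΩ (hf.pdx hΩ) hq, eqOn_pdx_fderiv hΩ (hf.pdy hΩ) hq]
  simp only [(eqOn_pdy_fderiv hΩ hf).fderiv_of_isOpen hΩ hq,
    (eqOn_pdx_fderiv hΩ hf).fderiv_of_isOpen hΩ hq]
  exact fderiv_fderiv_apply_comm hΩ hf hq _ _

lemma eqOn_pdx_pdx_pdt (hΩ : IsOpen Ω) (hf : ContDiffOn ℝ ∞ f Ω) :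
    EqOn (pdx (pdx (pdt f))) (pdt (pdx (pdx f))) Ω := fun _ hq =>
  ((eqOn_pdt_pdx hΩ hf).symm.pdx hΩ ((hf.pdt hΩ).pdx hΩ) hq).trans
    (eqOn_pdt_pdx hΩ (hf.pdx hΩ) hq).symm

lemma eqOn_pdx_pdx_pdy (hΩ : IsOpen Ω) (hf : ContDiffOn ℝ ∞ f Ω) :
    EqOn (pdx (pdx (pdy f))) (pdy (pdx (pdx f))) Ω := fun _ hq =>
  ((eqOn_pdy_pdx hΩ hf).symm.pdx hΩ ((hf.pdy hΩ).pdx hΩ) hq).trans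
    (eqOn_pdy_pdx hΩ (hf.pdx hΩ) hq).symm

end Partial

namespace IsSolutionOn

variable {Ω : Set (ℝ × ℝ × ℝ)} {u : ℝ × ℝ × ℝ → ℝ} {t x y : ℝ}

lemma pdt_eq (hΩ : IsOpen Ω) (hu : IsSolutionOn u Ω) (hp : (t, x, y) ∈ Ω) :
    pdt (pdt u) (t, x, y) + x * pdt (pdy u) (t, x, y) =
      x ^ 2 * pdt (pdx (pdx u)) (t, x, y) := by
  obtain ⟨h, e⟩ := hu
  have hl := (hasDerivAt_pdt hΩ (h.pdt hΩ) hp).add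
    ((hasDerivAt_pdt hΩ (h.pdy hΩ) hp).const_mul x)
  have hr := (hasDerivAt_pdt hΩ ((h.pdx hΩ).pdx hΩ) hp).const_mul (x ^ 2)
  refine hl.unique (hr.congr_of_eventuallyEq ?_)
  have hc : ContinuousAt (fun s : ℝ => (s, x, y)) t := by fun_prop
  filter_upwards [hc.preimage_mem_nhds (hΩ.mem_nhds hp)] with s hs using e _ hs

lemma pdy_eq (hΩ : IsOpen Ω) (hu : IsSolutionOn u Ω) (hp : (t, x, y) ∈ Ω) :
    pdy (pdt u) (t, x, y) + x * pdy (pdy u) (t, x, y) =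
      x ^ 2 * pdy (pdx (pdx u)) (t, x, y) := by
  obtain ⟨h, e⟩ := hu
  have hl := (hasDerivAt_pdy hΩ (h.pdt hΩ) hp).add
    ((hasDerivAt_pdy hΩ (h.pdy hΩ) hp).const_mul x)
  have hr := (hasDerivAt_pdy hΩ ((h.pdx hΩ).pdx hΩ) hp).const_mul (x ^ 2)
  refine hl.unique (hr.congr_of_eventuallyEq ?_)
  have hc : ContinuousAt (fun s : ℝ => (t, x, s)) y := by fun_prop
  filter_upwards [hc.preimage_mem_nhds (hΩ.mem_nhds hp)] with s hs using e _ hs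

lemma pdx_eq (hΩ : IsOpen Ω) (hu : IsSolutionOn u Ω) (hp : (t, x, y) ∈ Ω) :
    pdx (pdt u) (t, x, y) + (pdy u (t, x, y) + x * pdx (pdy u) (t, x, y)) =
      2 * x * pdx (pdx u) (t, x, y) + x ^ 2 * pdx (pdx (pdx u)) (t, x, y) := by
  obtain ⟨h, e⟩ := hu
  have hl := (hasDerivAt_pdx hΩ (h.pdt hΩ) hp).add
    ((hasDerivAt_id x).mul (hasDerivAt_pdx hΩ (h.pdy hΩ) hp))
  have hr := ((hasDerivAt_id x).pow 2).mul (hasDerivAt_pdx hΩ ((h.pdx hΩ).pdx hΩ) hp)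
  have hc : ContinuousAt (fun s : ℝ => (t, s, y)) x := by fun_prop
  have key := hl.unique (hr.congr_of_eventuallyEq (by
    filter_upwards [hc.preimage_mem_nhds (hΩ.mem_nhds hp)] with s hs using e _ hs))
  simp only [id_eq, Pi.pow_apply] at key
  linear_combination key

/-- The operator `D_y` preserves solutions. -/
theorem partial_y (hΩ : IsOpen Ω) (hu : IsSolutionOn u Ω) : IsSolutionOn (pdy u) Ω := by
  refine ⟨hu.1.pdy hΩ, ?_⟩
  rintro ⟨t, x, y⟩ hp
  rw [pdxx_eq_pdx_pdx, eqOn_pdt_pdy hΩ hu.1 hp, eqOn_pdx_pdx_pdy hΩ hu.1 hp]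
  exact hu.pdy_eq hΩ hp

/-- The operator `D_t` preserves solutions. -/
theorem partial_t (hΩ : IsOpen Ω) (hu : IsSolutionOn u Ω) : IsSolutionOn (pdt u) Ω := by
  refine ⟨hu.1.pdt hΩ, ?_⟩
  rintro ⟨t, x, y⟩ hp
  rw [pdxx_eq_pdx_pdx, ← eqOn_pdt_pdy hΩ hu.1 hp, eqOn_pdx_pdx_pdt hΩ hu.1 hp]
  exact hu.pdt_eq hΩ hp

/-- The operator `x D_x + y D_y` preserves solutions. -/
theorem scaling (hΩ : IsOpen Ω) (hu : IsSolutionOn u Ω) :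
    IsSolutionOn (fun p => p.2.1 * pdx u p + p.2.2 * pdy u p) Ω := by
  have h := hu.1
  have hx := h.pdx hΩ
  have hy := h.pdy hΩ
  have hW : ContDiffOn ℝ ∞ (fun p => p.2.1 * pdx u p + p.2.2 * pdy u p) Ω := by fun_prop
  refine ⟨hW, ?_⟩
  have hWx : EqOn (pdx fun p => p.2.1 * pdx u p + p.2.2 * pdy u p)
      (fun p => pdx u p + p.2.1 * pdx (pdx u) p + p.2.2 * pdx (pdy u) p) Ω := by
    rintro ⟨t, x, y⟩ hp
    refine (((hasDerivAt_id x).mul (hasDerivAt_pdx hΩ hx hp)).add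
      ((hasDerivAt_pdx hΩ hy hp).const_mul y)).deriv.trans ?_
    simp
  rintro ⟨t, x, y⟩ hp
  have hWt := (((hasDerivAt_pdt hΩ hx hp).const_mul x).add
    ((hasDerivAt_pdt hΩ hy hp).const_mul y)).deriv
  have hWy := (((hasDerivAt_pdy hΩ hx hp).const_mul x).add
    ((hasDerivAt_id y).mul (hasDerivAt_pdy hΩ hy hp))).deriv
  have hWxx := (hWx.pdx hΩ (hW.pdx hΩ) hp).trans
    (((hasDerivAt_pdx hΩ hx hp).add
      ((hasDerivAt_id x).mul (hasDerivAt_pdx hΩ (hx.pdx hΩ) hp))).add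
      ((hasDerivAt_pdx hΩ (hy.pdx hΩ) hp).const_mul y)).deriv
  refine (congrArg₂ (fun a b => a + x * b) hWt hWy).trans
    (Eq.trans ?_ (congrArg (fun a => x ^ 2 * a) hWxx.symm))
  simp only [id_eq, eqOn_pdt_pdx hΩ h hp, eqOn_pdt_pdy hΩ h hp, eqOn_pdy_pdx hΩ h hp,
    eqOn_pdx_pdx_pdy hΩ h hp]
  linear_combination x * hu.pdx_eq hΩ hp + y * hu.pdy_eq hΩ hp

/-- The operator `2xy D_x + y² D_y + x` preserves solutions. -/
theorem inversion (hΩ : IsOpen Ω) (hu : IsSolutionOn u Ω) :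
    IsSolutionOn (fun p => 2 * p.2.1 * p.2.2 * pdx u p + p.2.2 ^ 2 * pdy u p
      + p.2.1 * u p) Ω := by
  have h := hu.1
  have hx := h.pdx hΩ
  have hy := h.pdy hΩ
  have hW : ContDiffOn ℝ ∞ (fun p => 2 * p.2.1 * p.2.2 * pdx u p + p.2.2 ^ 2 * pdy u p
      + p.2.1 * u p) Ω := by fun_prop
  refine ⟨hW, ?_⟩
  have hWx : EqOn (pdx fun p => 2 * p.2.1 * p.2.2 * pdx u p + p.2.2 ^ 2 * pdy u p
      + p.2.1 * u p)
      (fun p => 2 * p.2.2 * pdx u p + 2 * p.2.1 * p.2.2 * pdx (pdx u) p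
        + p.2.2 ^ 2 * pdx (pdy u) p + (u p + p.2.1 * pdx u p)) Ω := by
    rintro ⟨t, x, y⟩ hp
    refine ((((((hasDerivAt_id x).const_mul 2).mul_const y).mul (hasDerivAt_pdx hΩ hx hp)).add
      ((hasDerivAt_pdx hΩ hy hp).const_mul (y ^ 2))).add
      ((hasDerivAt_id x).mul (hasDerivAt_pdx hΩ h hp))).deriv.trans ?_
    simp
  rintro ⟨t, x, y⟩ hp
  have hWt := ((((hasDerivAt_pdt hΩ hx hp).const_mul (2 * x * y)).add
    ((hasDerivAt_pdt hΩ hy hp).const_mul (y ^ 2))).add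
    ((hasDerivAt_pdt hΩ h hp).const_mul x)).deriv
  have hWy := (((((hasDerivAt_id y).const_mul (2 * x)).mul (hasDerivAt_pdy hΩ hx hp)).add
    (((hasDerivAt_id y).pow 2).mul (hasDerivAt_pdy hΩ hy hp))).add
    ((hasDerivAt_pdy hΩ h hp).const_mul x)).deriv
  have hWxx := (hWx.pdx hΩ (hW.pdx hΩ) hp).trans
    (((((hasDerivAt_pdx hΩ hx hp).const_mul (2 * y)).add
      ((((hasDerivAt_id x).const_mul 2).mul_const y).mul (hasDerivAt_pdx hΩ (hx.pdx hΩ) hp))).add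
      ((hasDerivAt_pdx hΩ (hy.pdx hΩ) hp).const_mul (y ^ 2))).add
      ((hasDerivAt_pdx hΩ h hp).add
        ((hasDerivAt_id x).mul (hasDerivAt_pdx hΩ hx hp)))).deriv
  refine (congrArg₂ (fun a b => a + x * b) hWt hWy).trans
    (Eq.trans ?_ (congrArg (fun a => x ^ 2 * a) hWxx.symm))
  simp only [id_eq, Pi.pow_apply, eqOn_pdt_pdx hΩ h hp, eqOn_pdt_pdy hΩ h hp,
    eqOn_pdy_pdx hΩ h hp, eqOn_pdx_pdx_pdy hΩ h hp]
  have e : pdt u (t, x, y) + x * pdy u (t, x, y) =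
      x ^ 2 * pdx (pdx u) (t, x, y) := hu.2 _ hp
  linear_combination 2 * x * y * hu.pdx_eq hΩ hp + y ^ 2 * hu.pdy_eq hΩ hp + x * e

end IsSolutionOn

/-- The Lie-symmetry operators `P^y = D_y`, `D = x D_x + y D_y`,
`K = 2xy D_x + y² D_y + x` and `P^t = D_t` map solutions of the fine Kolmogorov
backward equation on an open set `Ω` again to solutions on `Ω`. -/
theorem stmt_1 (Ω : Set (ℝ × ℝ × ℝ)) (hΩ : IsOpen Ω)
    (u : ℝ × ℝ × ℝ → ℝ) (hu : IsSolutionOn u Ω) :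
    IsSolutionOn (fun p => pdy u p) Ω ∧
    IsSolutionOn (fun p => p.2.1 * pdx u p + p.2.2 * pdy u p) Ω ∧
    IsSolutionOn
      (fun p => 2 * p.2.1 * p.2.2 * pdx u p + p.2.2 ^ 2 * pdy u p + p.2.1 * u p) Ω ∧
    IsSolutionOn (fun p => pdt u p) Ω :=
  ⟨hu.partial_y hΩ, hu.scaling hΩ, hu.inversion hΩ, hu.partial_t hΩ⟩
end

section
/- In E one has the operator identity D∘D − D − K∘P = (p ↦ x²·∂_x(∂_x p) − x·∂_y p); that is, for every polynomial p ∈ ℝ[x,y], (D(D p)) − D p − K(P p) = x²·∂_x²p − x·∂_y p. (Equivalently, the operator L = D_t + xD_y − x²D_x² of the fine Kolmogorov backward equation can be represented through its Lie-symmetry operators as L = P^t − D² + ½(P^y K + K P^y).) -/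
open MvPolynomial

/-- The algebra of `ℝ`-linear endomorphisms of the real polynomial ring in two
variables `x := X 0`, `y := X 1`. -/
noncomputable abbrev E : Type := Module.End ℝ (MvPolynomial (Fin 2) ℝ)

/-- The partial derivative `∂_x` as a linear endomorphism. -/
noncomputable def Dx : E := (pderiv (0 : Fin 2)).toLinearMap

/-- The partial derivative `∂_y` as a linear endomorphism. -/
noncomputable def Dy : E := (pderiv (1 : Fin 2)).toLinearMap

/-- Multiplication by the polynomial `q` as a linear endomorphism. -/
noncomputable def M (q : MvPolynomial (Fin 2) ℝ) : E := LinearMap.mulLeft ℝ q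

/-- The Lie-symmetry operator `P = ∂_y`. -/
noncomputable def P : E := Dy

/-- The Lie-symmetry operator `D = x ∂_x + y ∂_y`. -/
noncomputable def D : E := M (X 0) * Dx + M (X 1) * Dy

/-- The Lie-symmetry operator `K = 2xy ∂_x + y² ∂_y + x`. -/
noncomputable def K : E := M (2 * X 0 * X 1) * Dx + M (X 1 ^ 2) * Dy + M (X 0)

/-- Partial derivatives of multivariate polynomials commute. -/
theorem pderiv_pderiv_comm {R σ : Type*} [CommRing R] (i j : σ) (p : MvPolynomial σ R) :
    pderiv i (pderiv j p) = pderiv j (pderiv i p) := by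
  classical
  have h : ⁅pderiv (R := R) i, pderiv j⁆ = 0 := MvPolynomial.derivation_ext fun k => by
    rw [Derivation.commutator_apply]
    simp [pderiv_X, Pi.single_apply, apply_ite]
  rw [← sub_eq_zero, ← Derivation.commutator_apply, h, Derivation.zero_apply]

/-- The operator `L = D_t + x D_y − x² D_x²` of the fine Kolmogorov backward equation
is represented through Lie-symmetry operators: `D∘D − D − K∘P = x²∂_x∂_x − x∂_y`,
i.e. `L = P^t − D² + ½(P^y K + K P^y)`. -/
theorem stmt_2 : ∀ p : MvPolynomial (Fin 2) ℝ,
    D (D p) - D p - K (P p) =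
      X 0 ^ 2 * pderiv (0 : Fin 2) (pderiv (0 : Fin 2) p) - X 0 * pderiv (1 : Fin 2) p := by
  intro p
  simp only [D, K, P, M, Dx, Dy, LinearMap.add_apply, Module.End.mul_apply,
    LinearMap.mulLeft_apply, Derivation.coeFn_coe, map_add,
    Derivation.leibniz, smul_eq_mul, pderiv_X_self, pderiv_X_of_ne one_ne_zero,
    pderiv_X_of_ne zero_ne_one, pderiv_pderiv_comm (1 : Fin 2) 0 p]
  ring
end

section
/- In E the operators P, D, K satisfy the commutation relations P∘D − D∘P = P, P∘K − K∘P = 2·D, and D∘K − K∘D = K. (These mirror the nontrivial commutation relations [P^y, D] = P^y, [P^y, K] = 2D, [D, K] = K of the essential Lie invariance algebra of the fine Kolmogorov backward equation.) -/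
open MvPolynomial

theorem P_apply (p : MvPolynomial (Fin 2) ℝ) : P p = pderiv 1 p := rfl

theorem D_apply (p : MvPolynomial (Fin 2) ℝ) :
    D p = X 0 * pderiv 0 p + X 1 * pderiv 1 p := rfl

theorem K_apply (p : MvPolynomial (Fin 2) ℝ) :
    K p = 2 * X 0 * X 1 * pderiv 0 p + X 1 ^ 2 * pderiv 1 p + X 0 * p := rfl

/-- Partial derivatives of multivariate polynomials commute. -/
theorem pderiv_comm_apply {σ R : Type*} [CommRing R] (i j : σ) (p : MvPolynomial σ R) :
    pderiv i (pderiv j p) = pderiv j (pderiv i p) := by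
  classical
  have h : ⁅pderiv (R := R) i, pderiv (R := R) j⁆ = 0 := by
    refine MvPolynomial.derivation_ext fun k => ?_
    simp [Derivation.commutator_apply, pderiv_X, Pi.single_apply, apply_ite]
  exact sub_eq_zero.mp (DFunLike.congr_fun h p)

/-- Commutation relations `[P, D] = P`, `[P, K] = 2D`, `[D, K] = K` of the
Lie-symmetry operators of the fine Kolmogorov backward equation. -/
theorem stmt_3 :
    P * D - D * P = P ∧
    P * K - K * P = (2 : ℝ) • D ∧
    D * K - K * D = K := by
  have h01 : pderiv (R := ℝ) (0 : Fin 2) (X 1) = 0 := pderiv_X_of_ne (by decide)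
  have h10 : pderiv (R := ℝ) (1 : Fin 2) (X 0) = 0 := pderiv_X_of_ne (by decide)
  have h2 (i : Fin 2) : pderiv i (2 : MvPolynomial (Fin 2) ℝ) = 0 :=
    Derivation.map_natCast _ 2
  refine ⟨?_, ?_, ?_⟩ <;> refine LinearMap.ext fun p => ?_ <;>
    simp only [LinearMap.sub_apply, LinearMap.smul_apply, Module.End.mul_apply, P_apply, D_apply,
      K_apply, map_add, Derivation.leibniz, Derivation.leibniz_pow, pderiv_X_self, h01, h10, h2,
      pderiv_comm_apply 1 0 p, smul_eq_mul, ofNat_smul_eq_nsmul] <;>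
    ring
end

section
/- The family of operators indexed by triples (a,b,c) ∈ ℕ³ given by the monomials P^a ∘ D^b ∘ K^c (a-fold composite of P, followed by b-fold composite of D, followed by c-fold composite of K) is linearly independent over ℝ in E, and its ℝ-linear span equals the unital ℝ-subalgebra Algebra.adjoin ℝ {P, D, K} of E generated by P, D and K. In particular these monomials constitute a basis of the associative algebra Υ_𝔣 generated by P, D, K. -/
open MvPolynomial

theorem pderiv_zero_one_comm (p : MvPolynomial (Fin 2) ℝ) :
    pderiv 0 (pderiv 1 p) = pderiv 1 (pderiv 0 p) := by
  ext m
  simp only [coeff_pderiv, add_right_comm m]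
  simp
  ring

theorem pderiv_two (i : Fin 2) : pderiv i (2 : MvPolynomial (Fin 2) ℝ) = 0 :=
  (pderiv i).map_natCast 2

theorem D_mul_P : D * P = P * D - P := by
  refine LinearMap.ext fun p => ?_
  simp [Module.End.mul_apply, P_apply, D_apply, pderiv_zero_one_comm, Derivation.leibniz]
  ring

theorem K_mul_D : K * D = D * K - K := by
  refine LinearMap.ext fun p => ?_
  simp [Module.End.mul_apply, K_apply, D_apply, pderiv_zero_one_comm, pderiv_two,
    Derivation.leibniz]
  ring

theorem K_mul_P : K * P = P * K - (2 : ℝ) • D := by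
  refine LinearMap.ext fun p => ?_
  simp [Module.End.mul_apply, K_apply, D_apply, P_apply, pderiv_zero_one_comm, pderiv_two,
    Derivation.leibniz, MvPolynomial.smul_eq_C_mul, map_ofNat C]
  ring

/-- The linear span of the ordered monomials `P ^ a * D ^ b * K ^ c`. -/
noncomputable def monomialSpan : Submodule ℝ E :=
  Submodule.span ℝ (Set.range fun a : ℕ × ℕ × ℕ => P ^ a.1 * D ^ a.2.1 * K ^ a.2.2)

theorem monomial_mem (a b c : ℕ) : P ^ a * D ^ b * K ^ c ∈ monomialSpan :=
  Submodule.subset_span ⟨(a, b, c), rfl⟩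

theorem mul_mem_monomialSpan {T : E}
    (hT : ∀ a b c, T * (P ^ a * D ^ b * K ^ c) ∈ monomialSpan) {S : E}
    (hS : S ∈ monomialSpan) : T * S ∈ monomialSpan := by
  have : monomialSpan ≤ monomialSpan.comap (LinearMap.mulLeft ℝ T) :=
    Submodule.span_le.2 (by rintro _ ⟨⟨a, b, c⟩, rfl⟩; exact hT a b c)
  exact this hS

theorem P_mul_mem {S : E} (hS : S ∈ monomialSpan) : P * S ∈ monomialSpan :=
  mul_mem_monomialSpan (fun a b c => by
    simpa only [pow_succ', mul_assoc] using monomial_mem (a + 1) b c) hS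

theorem D_mul_mem {S : E} (hS : S ∈ monomialSpan) : D * S ∈ monomialSpan := by
  refine mul_mem_monomialSpan (fun a b c => ?_) hS
  induction a with
  | zero => simpa only [pow_succ', pow_zero, one_mul, mul_assoc] using monomial_mem 0 (b + 1) c
  | succ a ih =>
    have h : D * (P ^ (a + 1) * D ^ b * K ^ c) =
        P * (D * (P ^ a * D ^ b * K ^ c)) - P ^ (a + 1) * D ^ b * K ^ c := by
      calc _ = D * P * (P ^ a * D ^ b * K ^ c) := by simp only [pow_succ', mul_assoc]
        _ = _ := by rw [D_mul_P, sub_mul]; simp only [pow_succ', mul_assoc]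
    rw [h]
    exact sub_mem (P_mul_mem ih) (monomial_mem _ _ _)

theorem K_mul_mem {S : E} (hS : S ∈ monomialSpan) : K * S ∈ monomialSpan := by
  refine mul_mem_monomialSpan (fun a b c => ?_) hS
  induction a with
  | zero =>
    induction b with
    | zero => simpa only [pow_succ', pow_zero, one_mul] using monomial_mem 0 0 (c + 1)
    | succ b ih =>
      have h : K * (P ^ 0 * D ^ (b + 1) * K ^ c) =
          D * (K * (P ^ 0 * D ^ b * K ^ c)) - K * (P ^ 0 * D ^ b * K ^ c) := by
        calc _ = K * D * (D ^ b * K ^ c) := by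
              simp only [pow_succ', pow_zero, one_mul, mul_assoc]
          _ = _ := by rw [K_mul_D, sub_mul]; simp only [pow_zero, one_mul, mul_assoc]
      rw [h]
      exact sub_mem (D_mul_mem ih) ih
  | succ a ih =>
    have h : K * (P ^ (a + 1) * D ^ b * K ^ c) =
        P * (K * (P ^ a * D ^ b * K ^ c)) - (2 : ℝ) • (D * (P ^ a * D ^ b * K ^ c)) := by
      calc _ = K * P * (P ^ a * D ^ b * K ^ c) := by simp only [pow_succ', mul_assoc]
        _ = _ := by rw [K_mul_P, sub_mul, smul_mul_assoc]; simp only [mul_assoc]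
    rw [h]
    exact sub_mem (P_mul_mem ih) (Submodule.smul_mem _ _ (D_mul_mem (monomial_mem _ _ _)))

theorem monomialSpan_eq_adjoin :
    monomialSpan = Subalgebra.toSubmodule (Algebra.adjoin ℝ {P, D, K}) := by
  apply le_antisymm
  · refine Submodule.span_le.2 ?_
    rintro _ ⟨⟨a, b, c⟩, rfl⟩
    have h : ∀ T ∈ ({P, D, K} : Set E), T ∈ Algebra.adjoin ℝ {P, D, K} :=
      fun T hT => Algebra.subset_adjoin hT
    exact Subalgebra.mul_mem _ (Subalgebra.mul_mem _ (pow_mem (h P (by simp)) a)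
      (pow_mem (h D (by simp)) b))
      (pow_mem (h K (by simp)) c)
  · intro T hT
    rw [Subalgebra.mem_toSubmodule] at hT
    have h : ∀ S ∈ monomialSpan, T * S ∈ monomialSpan := by
      induction hT using Algebra.adjoin_induction with
      | mem T hT =>
        rcases hT with rfl | rfl | rfl
        exacts [fun _ => P_mul_mem, fun _ => D_mul_mem, fun _ => K_mul_mem]
      | algebraMap r =>
        intro S hS
        rw [← Algebra.smul_def]
        exact Submodule.smul_mem _ _ hS
      | add T U _ _ hT hU =>
        intro S hS
        rw [add_mul]
        exact add_mem (hT S hS) (hU S hS)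
      | mul T U _ _ hT hU =>
        intro S hS
        rw [mul_assoc]
        exact hT _ (hU S hS)
    simpa using h 1 (by simpa using monomial_mem 0 0 0)

theorem P_pow_coeff (a n k : ℕ) (p : MvPolynomial (Fin 2) ℝ) :
    coeff (Finsupp.single 0 n + Finsupp.single 1 k) ((P ^ a) p) =
      (ascPochhammer ℝ a).eval ((k : ℝ) + 1) *
        coeff (Finsupp.single 0 n + Finsupp.single 1 (k + a)) p := by
  induction a generalizing p with
  | zero => simp
  | succ a ih =>
    rw [pow_succ, Module.End.mul_apply, ih, P_apply, coeff_pderiv, ascPochhammer_succ_eval,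
      add_assoc, ← Finsupp.single_add, add_assoc]
    simp only [Finsupp.add_apply, Finsupp.single_eq_same, Finsupp.single_apply]
    simp
    ring

theorem coeff_X_mul_pderiv (i : Fin 2) (m : Fin 2 →₀ ℕ) (p : MvPolynomial (Fin 2) ℝ) :
    coeff m (X i * pderiv i p) = m i * coeff m p := by
  rw [coeff_X_mul']
  split_ifs with h
  · have h1 : 1 ≤ m i := Nat.one_le_iff_ne_zero.2 (Finsupp.mem_support_iff.1 h)
    rw [coeff_pderiv, tsub_add_cancel_of_le (Finsupp.single_le_iff.2 h1), mul_comm]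
    simp [Nat.cast_sub h1]
  · simp [Finsupp.notMem_support_iff.1 h]

theorem D_pow_coeff (b n k : ℕ) (p : MvPolynomial (Fin 2) ℝ) :
    coeff (Finsupp.single 0 n + Finsupp.single 1 k) ((D ^ b) p) =
      ((n : ℝ) + k) ^ b * coeff (Finsupp.single 0 n + Finsupp.single 1 k) p := by
  induction b generalizing p with
  | zero => simp
  | succ b ih =>
    rw [pow_succ, Module.End.mul_apply, ih, D_apply, coeff_add, coeff_X_mul_pderiv,
      coeff_X_mul_pderiv]
    simp
    ring

theorem X_mul_pderiv_X_pow (i : Fin 2) (j : ℕ) :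
    X i * pderiv i (X i ^ j : MvPolynomial (Fin 2) ℝ) =
      (j : MvPolynomial (Fin 2) ℝ) * X i ^ j := by
  cases j with
  | zero => simp
  | succ j =>
    simp [Derivation.leibniz_pow]
    ring

theorem K_pow_apply (c n m : ℕ) : ∃ q : MvPolynomial (Fin 2) ℝ,
    (K ^ c) (X 0 ^ n * X 1 ^ m) =
      C ((ascPochhammer ℝ c).eval (2 * (n : ℝ) + m)) * (X 0 ^ n * X 1 ^ (m + c)) +
        X 0 ^ (n + 1) * q := by
  induction c with
  | zero => exact ⟨0, by simp⟩
  | succ c ih =>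
    obtain ⟨q, hq⟩ := ih
    refine ⟨C ((ascPochhammer ℝ c).eval (2 * (n : ℝ) + m)) * X 1 ^ (m + c) +
      2 * ((n : MvPolynomial (Fin 2) ℝ) + 1) * X 1 * q + 2 * X 0 * X 1 * pderiv 0 q +
      X 1 ^ 2 * pderiv 1 q + X 0 * q, ?_⟩
    rw [pow_succ', Module.End.mul_apply, hq, K_apply, ascPochhammer_succ_eval]
    have h01 : ∀ j : ℕ, pderiv 0 (X 1 ^ j : MvPolynomial (Fin 2) ℝ) = 0 := by
      simp [Derivation.leibniz_pow]
    have h10 : ∀ j : ℕ, pderiv 1 (X 0 ^ j : MvPolynomial (Fin 2) ℝ) = 0 := by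
      simp [Derivation.leibniz_pow]
    simp only [map_add, map_mul, Derivation.leibniz, h01, h10, smul_eq_mul, pderiv_C, map_natCast,
      map_ofNat]
    set A : MvPolynomial (Fin 2) ℝ := C ((ascPochhammer ℝ c).eval (2 * (n : ℝ) + m))
    have e0 := X_mul_pderiv_X_pow 0 n
    have e0' := X_mul_pderiv_X_pow 0 (n + 1)
    have e1 := X_mul_pderiv_X_pow 1 (m + c)
    push_cast at e0 e0' e1
    linear_combination (2 * X 1 * A * X 1 ^ (m + c)) * e0 + 2 * X 1 * q * e0' +
      X 1 * A * X 0 ^ n * e1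

theorem K_pow_coeff (c n m k : ℕ) :
    coeff (Finsupp.single 0 n + Finsupp.single 1 k) ((K ^ c) (X 0 ^ n * X 1 ^ m)) =
      if m + c = k then (ascPochhammer ℝ c).eval (2 * (n : ℝ) + m) else 0 := by
  obtain ⟨q, hq⟩ := K_pow_apply c n m
  have h : coeff (Finsupp.single 0 n + Finsupp.single 1 k)
      (X 0 ^ (n + 1) * q : MvPolynomial (Fin 2) ℝ) = 0 := by
    rw [X_pow_eq_monomial, coeff_monomial_mul', if_neg]
    intro h
    have := h 0
    simp at this
  rw [hq, coeff_add, h, add_zero, coeff_C_mul, X_pow_eq_monomial, X_pow_eq_monomial,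
    monomial_mul, coeff_monomial]
  have : (Finsupp.single (0 : Fin 2) n + Finsupp.single 1 (m + c) =
    Finsupp.single 0 n + Finsupp.single 1 k) ↔ m + c = k := by
    rw [add_right_inj, (Finsupp.single_injective _).eq_iff]
  simp only [this, mul_one, mul_ite, mul_zero]

theorem monomial_coeff (a b c n m k : ℕ) :
    coeff (Finsupp.single 0 n + Finsupp.single 1 k)
        ((P ^ a * D ^ b * K ^ c) (X 0 ^ n * X 1 ^ m)) =
      if m + c = k + a then
        (ascPochhammer ℝ a).eval ((k : ℝ) + 1) * (((n : ℝ) + (k + a)) ^ b *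
          (ascPochhammer ℝ c).eval (2 * (n : ℝ) + m)) else 0 := by
  rw [Module.End.mul_apply, Module.End.mul_apply, P_pow_coeff, D_pow_coeff, K_pow_coeff]
  split_ifs <;> simp

theorem polynomial_eq_zero_of_eval_natCast {p : Polynomial ℝ} (N : ℕ)
    (h : ∀ n : ℕ, N ≤ n → p.eval (n : ℝ) = 0) : p = 0 := by
  refine Polynomial.eq_zero_of_infinite_isRoot p ?_
  refine ((Set.Ici_infinite N).image (f := fun n : ℕ => (n : ℝ))
    Nat.cast_injective.injOn).mono ?_
  rintro _ ⟨n, hn, rfl⟩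
  exact h n hn

theorem linearIndependent_monomials :
    LinearIndependent ℝ (fun a : ℕ × ℕ × ℕ => P ^ a.1 * D ^ a.2.1 * K ^ a.2.2) := by
  rw [linearIndependent_iff]
  intro g hg
  suffices H : ∀ a b c, g (a, b, c) = 0 by ext ⟨a, b, c⟩; exact H a b c
  intro a
  induction a using Nat.strong_induction_on with
  | _ a ih =>
  intro b c
  -- the coefficient of `x ^ n * y ^ (j + c)` in the image of `x ^ n * y ^ (j + a)`
  have h1 (n j : ℕ) : ∑ i ∈ g.support, g i * (if a + i.2.2 = c + i.1 then
      (ascPochhammer ℝ i.1).eval ((j : ℝ) + c + 1) * (((n : ℝ) + (j + c + i.1)) ^ i.2.1 *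
        (ascPochhammer ℝ i.2.2).eval (2 * (n : ℝ) + (j + a))) else 0) = 0 := by
    have := congrArg (fun T : E => coeff (Finsupp.single 0 n + Finsupp.single 1 (j + c))
      (T (X 0 ^ n * X 1 ^ (j + a)))) hg
    simp only [Finsupp.linearCombination_apply, Finsupp.sum, LinearMap.sum_apply,
      LinearMap.smul_apply, coeff_sum, coeff_smul, monomial_coeff, LinearMap.zero_apply,
      coeff_zero, smul_eq_mul, add_assoc, Nat.add_left_cancel_iff, Nat.cast_add] at this
    simpa only [add_assoc] using this
  -- this identity is polynomial in `j`, so it may be evaluated at `j = -(c + 1 + a)`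
  have h2 (n : ℕ) : ∑ i ∈ g.support, g i * (if a + i.2.2 = c + i.1 then
      (ascPochhammer ℝ i.1).eval (-(a : ℝ)) * (((n : ℝ) + (i.1 - 1 - a)) ^ i.2.1 *
        (ascPochhammer ℝ i.2.2).eval (2 * (n : ℝ) - c - 1)) else 0) = 0 := by
    let p : Polynomial ℝ := ∑ i ∈ g.support, Polynomial.C (g i) * (if a + i.2.2 = c + i.1 then
      (ascPochhammer ℝ i.1).comp (.X + .C ((c : ℝ) + 1)) *
        ((.X + .C ((n : ℝ) + c + i.1)) ^ i.2.1 *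
        (ascPochhammer ℝ i.2.2).comp (.X + .C (2 * (n : ℝ) + a))) else 0)
    have hp : p = 0 := by
      refine polynomial_eq_zero_of_eval_natCast 0 fun j _ => ?_
      rw [← h1 n j, Polynomial.eval_finsetSum]
      refine Finset.sum_congr rfl fun i _ => ?_
      split_ifs
      · simp only [Polynomial.eval_mul, Polynomial.eval_C, Polynomial.eval_comp,
          Polynomial.eval_add, Polynomial.eval_X, Polynomial.eval_pow]
        ring_nf
      · simp
    have := congrArg (Polynomial.eval (-((c : ℝ) + 1 + a))) hp
    rw [Polynomial.eval_finsetSum, Polynomial.eval_zero] at this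
    refine (Finset.sum_congr rfl fun i _ => ?_).trans this
    split_ifs
    · simp only [Polynomial.eval_mul, Polynomial.eval_C, Polynomial.eval_comp,
        Polynomial.eval_add, Polynomial.eval_X, Polynomial.eval_pow]
      ring_nf
    · simp
  -- only the terms with exponents `(a, b', c)` survive
  let q : Polynomial ℝ := ∑ i ∈ g.support,
    if i.1 = a ∧ i.2.2 = c then Polynomial.monomial i.2.1 (g i) else 0
  have hq : q.comp (.X - .C 1) = 0 := by
    refine polynomial_eq_zero_of_eval_natCast (c + 1) fun n hn => ?_
    have hn' : (c : ℝ) + 1 ≤ n := by exact_mod_cast hn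
    have hA : (ascPochhammer ℝ a).eval (-(a : ℝ)) ≠ 0 := by
      rw [Ne, ascPochhammer_eval_eq_zero_iff]
      rintro ⟨k, hk, hka⟩
      rw [neg_neg, Nat.cast_inj] at hka
      omega
    have hC : (ascPochhammer ℝ c).eval (2 * (n : ℝ) - c - 1) ≠ 0 :=
      (ascPochhammer_pos c _ (by linarith [(Nat.cast_nonneg c : (0 : ℝ) ≤ c)])).ne'
    refine (mul_eq_zero.1 ?_).resolve_right (mul_ne_zero hA hC)
    rw [← h2 n, Polynomial.eval_comp, Polynomial.eval_finsetSum, Finset.sum_mul]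
    refine Finset.sum_congr rfl ?_
    rintro ⟨a', b', c'⟩ _
    dsimp only
    rcases lt_trichotomy a' a with hlt | rfl | hgt
    · simp [ih a' hlt, hlt.ne]
    · by_cases hc : c' = c
      · subst hc
        simp [add_comm]
        ring
      · have : ¬ a' + c' = c + a' := by omega
        simp only [hc, this, and_false, if_false, Polynomial.eval_zero, zero_mul, mul_zero]
    · simp [hgt.ne', ascPochhammer_eval_neg_coe_nat_of_lt hgt]
  have hq0 : q = 0 := by
    have := congrArg (fun r => r.comp (.X + .C 1)) hq
    simpa [Polynomial.comp_assoc] using this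
  have := congrArg (fun r => r.coeff b) hq0
  simp only [q, Polynomial.finsetSum_coeff, Polynomial.coeff_zero] at this
  rw [Finset.sum_eq_single (a, b, c)] at this
  · simpa using this
  · rintro ⟨a', b', c'⟩ _ hne
    dsimp only
    split_ifs with h
    · obtain ⟨rfl, rfl⟩ := h
      rw [Polynomial.coeff_monomial, if_neg]
      rintro rfl
      exact hne rfl
    · simp
  · intro h
    simp [Finsupp.notMem_support_iff.1 h]

/-- The monomials `P^a D^b K^c`, `(a,b,c) ∈ ℕ³`, form a basis of the associative
unital subalgebra of `E` generated by `P`, `D` and `K`. -/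
theorem stmt_6 :
    LinearIndependent ℝ (fun a : ℕ × ℕ × ℕ => P ^ a.1 * D ^ a.2.1 * K ^ a.2.2) ∧
    Submodule.span ℝ (Set.range fun a : ℕ × ℕ × ℕ => P ^ a.1 * D ^ a.2.1 * K ^ a.2.2) =
      Subalgebra.toSubmodule (Algebra.adjoin ℝ {P, D, K}) := by
  exact ⟨linearIndependent_monomials, monomialSpan_eq_adjoin⟩
end

section
/- For every natural number n ≥ 1 the following operator identity holds in E: P^{n+1} ∘ K^{n} = (∏_{k=1}^{n} (P∘K + (2k)·D + (k² + k)·id)) ∘ P, where id is the identity endomorphism and the product of the n factors may be taken in any order, since the factors P∘K + (2k)·D + (k²+k)·id, k = 1, …, n, pairwise commute. (This is the operator identity D_y^{n+1}K^n = (∏_{k=1}^n (D_yK + 2kD + k² + k)) D_y, with D the dilation operator, underlying the interpretation of the generalized reductions in terms of iterated action by the Lie-symmetry operator K.) -/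
open MvPolynomial

theorem pderiv_two_s8 {R σ : Type*} [CommRing R] (i : σ) :
    pderiv i (2 : MvPolynomial σ R) = 0 :=
  (pderiv i).map_natCast 2

theorem P_mul_K : P * K = K * P + (2 : ℝ) • D := by
  refine LinearMap.ext fun p => ?_
  simp only [Module.End.mul_apply, LinearMap.add_apply, two_smul, P_apply, K_apply,
    D_apply, map_add, Derivation.leibniz, Derivation.leibniz_pow, pderiv_two_s8, pderiv_X_self,
    pderiv_X_of_ne zero_ne_one, pderiv_pderiv_comm (1 : Fin 2) 0, smul_eq_mul]
  ring

theorem P_mul_D : P * D = D * P + P := by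
  refine LinearMap.ext fun p => ?_
  simp only [Module.End.mul_apply, LinearMap.add_apply, P_apply, D_apply, map_add,
    Derivation.leibniz, pderiv_X_self, pderiv_X_of_ne zero_ne_one, pderiv_pderiv_comm (1 : Fin 2) 0,
    smul_eq_mul]
  ring

theorem D_mul_K : D * K = K * D + K := by
  refine LinearMap.ext fun p => ?_
  simp only [Module.End.mul_apply, LinearMap.add_apply, K_apply, D_apply, map_add,
    Derivation.leibniz, Derivation.leibniz_pow, pderiv_two_s8, pderiv_X_self,
    pderiv_X_of_ne zero_ne_one, pderiv_X_of_ne one_ne_zero, pderiv_pderiv_comm (1 : Fin 2) 0,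
    smul_eq_mul, nsmul_eq_mul]
  push_cast
  ring

theorem commute_P_mul_K_D : Commute (P * K) D := by
  have h : D * P = P * D - P := by rw [P_mul_D, add_sub_cancel_right]
  rw [commute_iff_eq, ← mul_assoc D, h, sub_mul, mul_assoc P D, D_mul_K, mul_add,
    add_sub_cancel_right, mul_assoc]

theorem commute_factor (a b a' b' : ℝ) :
    Commute (P * K + a • D + b • (1 : E)) (P * K + a' • D + b' • (1 : E)) := by
  have h := commute_P_mul_K_D
  refine .add_left (.add_right (.add_left (.add_right (.refl _) (h.smul_right _))
    (.add_right (h.symm.smul_left _) ?_)) ?_) ?_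
  · exact ((Commute.refl D).smul_left _).smul_right _
  · exact (Commute.one_right _).smul_right _
  · exact (Commute.one_left _).smul_left _

theorem P_mul_factor (a : ℝ) :
    P * (P * K + (2 * a) • D + (a ^ 2 + a) • (1 : E)) =
      (P * K + (2 * (a + 1)) • D + ((a + 1) ^ 2 + (a + 1)) • (1 : E)) * P := by
  have h : P * (P * K) = P * K * P + (2 : ℝ) • (D * P + P) := by
    conv_lhs => rw [P_mul_K, mul_add, mul_smul_comm, P_mul_D, ← mul_assoc]
  simp only [mul_add, add_mul, h, mul_smul_comm, smul_mul_assoc, P_mul_D, mul_one, one_mul]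
  module

theorem P_pow_succ_mul_K (n : ℕ) :
    P ^ (n + 1) * K =
      (P * K + (2 * (n : ℝ)) • D + ((n : ℝ) ^ 2 + (n : ℝ)) • (1 : E)) * P ^ n := by
  induction n with
  | zero => simp
  | succ n ih =>
    rw [pow_succ' P (n + 1), mul_assoc, ih, ← mul_assoc, P_mul_factor, mul_assoc, ← pow_succ']
    push_cast
    rfl

theorem noncommProd_Icc_one_succ {A : Type*} [Monoid A] (f : ℕ → A)
    (hf : ∀ s : Set ℕ, s.Pairwise (Function.onFun Commute f)) (n : ℕ) :
    (Finset.Icc 1 (n + 1)).noncommProd f (hf _) =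
      f (n + 1) * (Finset.Icc 1 n).noncommProd f (hf _) :=
  (Finset.noncommProd_congr (Finset.insert_Icc_right_eq_Icc_add_one (by omega)).symm
    (fun _ _ => rfl) _).trans (Finset.noncommProd_insert_of_notMem _ _ _ _ (by simp))

theorem pairwise_commute_factor (s : Set ℕ) :
    s.Pairwise (Function.onFun Commute fun k : ℕ =>
      P * K + (2 * (k : ℝ)) • D + ((k : ℝ) ^ 2 + (k : ℝ)) • (1 : E)) :=
  fun _ _ _ _ _ => commute_factor _ _ _ _

theorem P_pow_succ_mul_K_pow (n : ℕ) :
    P ^ (n + 1) * K ^ n =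
      (Finset.Icc 1 n).noncommProd
        (fun k => P * K + (2 * (k : ℝ)) • D + ((k : ℝ) ^ 2 + (k : ℝ)) • (1 : E))
        (pairwise_commute_factor _) * P := by
  induction n with
  | zero =>
    have h : (Finset.Icc 1 0).noncommProd
        (fun k : ℕ => P * K + (2 * (k : ℝ)) • D + ((k : ℝ) ^ 2 + (k : ℝ)) • (1 : E))
        (pairwise_commute_factor _) = 1 := Finset.noncommProd_empty _ _
    rw [h, zero_add, pow_one, pow_zero, one_mul, mul_one]
  | succ n ih =>
    rw [noncommProd_Icc_one_succ _ pairwise_commute_factor, mul_assoc, ← ih, pow_succ' K,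
      ← mul_assoc, P_pow_succ_mul_K, mul_assoc]

/-- For `n ≥ 1`: `P^{n+1} ∘ K^n = (∏_{k=1}^n (P∘K + 2k·D + (k²+k)·id)) ∘ P`,
where the factors pairwise commute (so the product may be taken in any order,
here as `Finset.noncommProd`). -/
theorem stmt_8 (n : ℕ) (hn : 1 ≤ n) :
    ∃ hc : (↑(Finset.Icc 1 n) : Set ℕ).Pairwise fun a b =>
        Commute (P * K + (2 * (a : ℝ)) • D + ((a : ℝ) ^ 2 + (a : ℝ)) • (1 : E))
                (P * K + (2 * (b : ℝ)) • D + ((b : ℝ) ^ 2 + (b : ℝ)) • (1 : E)),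
      P ^ (n + 1) * K ^ n =
        (Finset.Icc 1 n).noncommProd
          (fun k => P * K + (2 * (k : ℝ)) • D + ((k : ℝ) ^ 2 + (k : ℝ)) • (1 : E)) hc * P := by
  exact ⟨pairwise_commute_factor _, P_pow_succ_mul_K_pow n⟩
end

section
/- Let θ : ℝ → ℝ → ℝ be a smooth solution of the (1+1)-dimensional linear heat equation. Then the function u(t,x,y) := exp(−3t/16)·x^{1/4}·θ(y, 2√x) is a solution of the fine Kolmogorov backward equation on the open set {(t,x,y) ∈ ℝ³ : x > 0}. -/
open Real Set

theorem hasDerivAt_rpow_quarter {x : ℝ} (hx : 0 < x) :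
    HasDerivAt (fun r : ℝ => r ^ ((1 : ℝ) / 4)) (x ^ ((1 : ℝ) / 4) / (4 * x)) x := by
  refine (Real.hasDerivAt_rpow_const (p := (1 : ℝ) / 4) (Or.inl hx.ne')).congr_deriv ?_
  rw [Real.rpow_sub_one hx.ne']
  ring

theorem hasDerivAt_two_mul_sqrt {x : ℝ} (hx : 0 < x) :
    HasDerivAt (fun r : ℝ => 2 * √r) (1 / √x) x := by
  refine ((Real.hasDerivAt_sqrt hx.ne').const_mul 2).congr_deriv ?_
  field_simp

theorem hasDerivAt_rpow_quarter_mul_comp {f : ℝ → ℝ} {f' x : ℝ} (hx : 0 < x)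
    (hf : HasDerivAt f f' (2 * √x)) :
    HasDerivAt (fun r : ℝ => r ^ ((1 : ℝ) / 4) * f (2 * √r))
      (x ^ ((1 : ℝ) / 4) * (f (2 * √x) / (4 * x) + f' / √x)) x := by
  refine ((hasDerivAt_rpow_quarter hx).fun_mul
    (HasDerivAt.comp x hf (hasDerivAt_two_mul_sqrt hx))).congr_deriv ?_
  simp only [Function.comp_apply]
  ring

/-- The second derivative of `x ^ (1 / 4) * f (2 * √x)` has no first-order term in `f`. -/
theorem sq_mul_deriv_deriv_rpow_quarter_mul_comp {f : ℝ → ℝ} (hf : Differentiable ℝ f)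
    (hf' : Differentiable ℝ (deriv f)) {x : ℝ} (hx : 0 < x) :
    x ^ 2 * deriv (deriv fun r : ℝ => r ^ ((1 : ℝ) / 4) * f (2 * √r)) x =
      x ^ ((1 : ℝ) / 4) * (x * deriv (deriv f) (2 * √x) - 3 / 16 * f (2 * √x)) := by
  have hderiv : (deriv fun r : ℝ => r ^ ((1 : ℝ) / 4) * f (2 * √r)) =ᶠ[nhds x]
      fun r => r ^ ((1 : ℝ) / 4) * (f (2 * √r) / (4 * r) + deriv f (2 * √r) / √r) := by
    filter_upwards [lt_mem_nhds hx] with r hr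
    exact (hasDerivAt_rpow_quarter_mul_comp hr (hf _).hasDerivAt).deriv
  have hs : 0 < √x := Real.sqrt_pos.2 hx
  have hcomp : HasDerivAt (fun r : ℝ => f (2 * √r)) (deriv f (2 * √x) * (1 / √x)) x :=
    HasDerivAt.comp x (hf _).hasDerivAt (hasDerivAt_two_mul_sqrt hx)
  have hcomp' : HasDerivAt (fun r : ℝ => deriv f (2 * √r))
      (deriv (deriv f) (2 * √x) * (1 / √x)) x :=
    HasDerivAt.comp x (hf' _).hasDerivAt (hasDerivAt_two_mul_sqrt hx)
  have hmain := (hasDerivAt_rpow_quarter hx).fun_mul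
    ((hcomp.fun_div ((hasDerivAt_id' x).const_mul 4) (by positivity)).fun_add
      (hcomp'.fun_div (Real.hasDerivAt_sqrt hx.ne') hs.ne'))
  rw [hderiv.deriv_eq, hmain.deriv]
  generalize x ^ ((1 : ℝ) / 4) = q
  generalize f (2 * √x) = a
  generalize deriv f (2 * √x) = b
  generalize deriv (deriv f) (2 * √x) = c
  obtain ⟨s, hsx⟩ : ∃ s, s = √x := ⟨_, rfl⟩
  have hx2 : x = s ^ 2 := by rw [hsx, Real.sq_sqrt hx.le]
  rw [← hsx] at hs ⊢
  subst hx2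
  field_simp
  ring

/-- For any smooth solution `θ` of the (1+1)-dimensional linear heat equation,
`u(t,x,y) = e^{-3t/16} x^{1/4} θ(y, 2√x)` solves the fine Kolmogorov backward
equation on `{x > 0}`. -/
theorem stmt_9 (θ : ℝ → ℝ → ℝ)
    (hθ : ContDiff ℝ (⊤ : ℕ∞) fun q : ℝ × ℝ => θ q.1 q.2)
    (hheat : ∀ z1 z2 : ℝ, deriv (fun s => θ s z2) z1 = deriv (deriv (θ z1)) z2) :
    IsSolutionOn
      (fun p : ℝ × ℝ × ℝ =>
        Real.exp (-(3 * p.1) / 16) * p.2.1 ^ ((1 : ℝ) / 4) * θ p.2.2 (2 * Real.sqrt p.2.1))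
      {p : ℝ × ℝ × ℝ | 0 < p.2.1} := by
  refine ⟨fun p hp => ContDiffAt.contDiffWithinAt ?_, ?_⟩
  · have hne : p.2.1 ≠ 0 := ne_of_gt hp
    have hx : ContDiffAt ℝ (⊤ : ℕ∞) (fun p : ℝ × ℝ × ℝ => p.2.1) p := by fun_prop
    have hexp : ContDiffAt ℝ (⊤ : ℕ∞) (fun p : ℝ × ℝ × ℝ => Real.exp (-(3 * p.1) / 16)) p := by
      fun_prop
    have harg : ContDiffAt ℝ (⊤ : ℕ∞) (fun p : ℝ × ℝ × ℝ => (p.2.2, 2 * √p.2.1)) p :=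
      ContDiffAt.prodMk (by fun_prop) (contDiffAt_const.mul (hx.sqrt hne))
    exact (hexp.mul (hx.rpow_const_of_ne hne)).mul (hθ.contDiffAt.comp p harg)
  · rintro ⟨t, x, y⟩ hx
    replace hx : 0 < x := hx
    have hy : ContDiff ℝ (⊤ : ℕ∞) (θ y) := hθ.comp (contDiff_const.prodMk contDiff_id)
    have hsecond := sq_mul_deriv_deriv_rpow_quarter_mul_comp (hy.differentiable (by simp))
      ((contDiff_infty_iff_deriv.1 hy).2.differentiable (by simp)) hx
    have htime : HasDerivAt (fun s : ℝ => Real.exp (-(3 * s) / 16))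
        (Real.exp (-(3 * t) / 16) * (-(3 * 1) / 16)) t :=
      ((((hasDerivAt_id' t).const_mul 3).fun_neg).div_const 16).exp
    simp only [pdt, pdy, pdxx, deriv_mul_const_field, deriv_const_mul_field, htime.deriv, hheat]
    simp only [mul_assoc (Real.exp _), deriv_const_mul_field]
    rw [mul_left_comm (x ^ 2), hsecond]
    ring
end

section
/- Let θ : ℝ → ℝ → ℝ be a smooth solution of the (1+1)-dimensional linear heat equation. Then the function u(t,x,y) := exp(−t/4)·x^{1/2}·θ(t, ln x) is a solution of the fine Kolmogorov backward equation on the open set {(t,x,y) ∈ ℝ³ : x > 0}. -/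
open Real Set

/-- The operator `x * d/dx` acts on `x ^ a * f (log x)` as `a + d/dz` acts on `f`. -/
theorem hasDerivAt_rpow_mul_comp_log {f : ℝ → ℝ} {f' x : ℝ} (a : ℝ) (hx : 0 < x)
    (hf : HasDerivAt f f' (Real.log x)) :
    HasDerivAt (fun r => r ^ a * f (Real.log r))
      (x ^ (a - 1) * (a * f (Real.log x) + f')) x := by
  have h := (Real.hasDerivAt_rpow_const (p := a) (Or.inl hx.ne')).mul
    (hf.comp x (Real.hasDerivAt_log hx.ne'))
  refine h.congr_deriv ?_
  rw [Function.comp_apply, Real.rpow_sub_one hx.ne']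
  ring

/-- In the variable `z = log x`, `x ^ 2 * d²/dx²` acts on `x ^ (1 / 2) * f z` as `d²/dz² - 1 / 4`
acts on `f`. -/
theorem sq_mul_deriv_deriv_rpow_half_mul_comp_log {f : ℝ → ℝ} (hf : Differentiable ℝ f)
    (hf' : Differentiable ℝ (deriv f)) {x : ℝ} (hx : 0 < x) :
    x ^ 2 * deriv (deriv fun r => r ^ ((1 : ℝ) / 2) * f (Real.log r)) x =
      x ^ ((1 : ℝ) / 2) * (deriv (deriv f) (Real.log x) - f (Real.log x) / 4) := by
  have h1 : deriv (fun r => r ^ ((1 : ℝ) / 2) * f (Real.log r)) =ᶠ[nhds x] fun r =>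
      r ^ ((1 : ℝ) / 2 - 1) * ((1 : ℝ) / 2 * f (Real.log r) + deriv f (Real.log r)) := by
    filter_upwards [lt_mem_nhds hx] with r hr
    exact (hasDerivAt_rpow_mul_comp_log _ hr (hf _).hasDerivAt).deriv
  have h2 := hasDerivAt_rpow_mul_comp_log (f := fun z => (1 : ℝ) / 2 * f z + deriv f z)
    ((1 : ℝ) / 2 - 1) hx
    (((hf (Real.log x)).hasDerivAt.const_mul _).add (hf' (Real.log x)).hasDerivAt)
  rw [h1.deriv_eq, h2.deriv, Real.rpow_sub_one hx.ne', Real.rpow_sub_one hx.ne']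
  field_simp
  ring

/-- For any smooth solution `θ` of the (1+1)-dimensional linear heat equation,
`u(t,x,y) = e^{-t/4} x^{1/2} θ(t, ln x)` solves the fine Kolmogorov backward
equation on `{x > 0}`. -/
theorem stmt_10 (θ : ℝ → ℝ → ℝ)
    (hθ : ContDiff ℝ (⊤ : ℕ∞) fun q : ℝ × ℝ => θ q.1 q.2)
    (hheat : ∀ z1 z2 : ℝ, deriv (fun s => θ s z2) z1 = deriv (deriv (θ z1)) z2) :
    IsSolutionOn
      (fun p : ℝ × ℝ × ℝ =>
        Real.exp (-p.1 / 4) * p.2.1 ^ ((1 : ℝ) / 2) * θ p.1 (Real.log p.2.1))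
      {p : ℝ × ℝ × ℝ | 0 < p.2.1} := by
  constructor
  · intro p hp
    have hlog : ContDiffAt ℝ (⊤ : ℕ∞) (fun p : ℝ × ℝ × ℝ => Real.log p.2.1) p :=
      contDiffAt_snd.fst.log (ne_of_gt hp)
    have hpow : ContDiffAt ℝ (⊤ : ℕ∞) (fun p : ℝ × ℝ × ℝ => p.2.1 ^ ((1 : ℝ) / 2)) p :=
      contDiffAt_snd.fst.rpow_const_of_ne (ne_of_gt hp)
    have hexp : ContDiffAt ℝ (⊤ : ℕ∞) (fun p : ℝ × ℝ × ℝ => Real.exp (-p.1 / 4)) p :=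
      (contDiffAt_fst.neg.div_const 4).exp
    exact ((hexp.mul hpow).mul
      (hθ.contDiffAt.comp p (contDiffAt_fst.prodMk hlog))).contDiffWithinAt
  · rintro ⟨t, x, y⟩ hx
    replace hx : 0 < x := hx
    have hspace : ContDiff ℝ (⊤ : ℕ∞) (θ t) := hθ.comp (contDiff_const.prodMk contDiff_id)
    have htime : Differentiable ℝ fun s => θ s (Real.log x) :=
      (hθ.comp (contDiff_id.prodMk contDiff_const)).differentiable (by simp)
    have hspace' : Differentiable ℝ (deriv (θ t)) :=
      ((contDiff_infty_iff_deriv.1 hspace).2).differentiable (by simp)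
    have hexp : HasDerivAt (fun s : ℝ => Real.exp (-s / 4)) (Real.exp (-t / 4) * (-1 / 4)) t :=
      ((hasDerivAt_id t).neg.div_const 4).exp
    have ht := ((hexp.mul_const (x ^ ((1 : ℝ) / 2))).mul (htime t).hasDerivAt).deriv
    have hxx := sq_mul_deriv_deriv_rpow_half_mul_comp_log
      (hspace.differentiable (by simp)) hspace' hx
    rw [← hheat] at hxx
    simp only [pdt, pdy, pdxx, deriv_const, mul_assoc, deriv_const_mul_field]
    simp only [Pi.mul_def, mul_assoc] at ht
    rw [ht]
    linear_combination -Real.exp (-t / 4) * hxx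
end

section
/- Let μ ∈ ℝ and let w : ℝ → ℝ → ℝ be smooth. The function u(t,x,y) := exp(μt)·w(y,x) is a solution of the fine Kolmogorov backward equation on all of ℝ³ if and only if w satisfies the reduced equation z₂·∂w/∂z₁(z₁,z₂) = z₂²·∂²w/∂z₂²(z₁,z₂) − μ·w(z₁,z₂) for all (z₁,z₂) ∈ ℝ². (This is Lie reduction 1.1 of the equation, corresponding to the subalgebra ⟨P^t + μ I⟩.) -/
open Real Set

/-- The time derivative of `e^{μt} w(y,x)`. -/
lemma pdt_exp_mul (μ : ℝ) (w : ℝ → ℝ → ℝ) (t x y : ℝ) :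
    pdt (fun p : ℝ × ℝ × ℝ => Real.exp (μ * p.1) * w p.2.2 p.2.1) (t, x, y) =
      Real.exp (μ * t) * (μ * w y x) := by
  have h : HasDerivAt (fun s : ℝ => Real.exp (μ * s) * w y x)
      (Real.exp (μ * t) * (μ * 1) * w y x) t :=
    (((hasDerivAt_id t).const_mul μ).exp).mul_const _
  exact h.deriv.trans (by ring)

lemma pdy_exp_mul (μ : ℝ) (w : ℝ → ℝ → ℝ) (t x y : ℝ) :
    pdy (fun p : ℝ × ℝ × ℝ => Real.exp (μ * p.1) * w p.2.2 p.2.1) (t, x, y) =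
      Real.exp (μ * t) * deriv (fun s => w s x) y := by
  simp [pdy]

lemma pdxx_exp_mul (μ : ℝ) (w : ℝ → ℝ → ℝ) (t x y : ℝ) :
    pdxx (fun p : ℝ × ℝ × ℝ => Real.exp (μ * p.1) * w p.2.2 p.2.1) (t, x, y) =
      Real.exp (μ * t) * deriv (deriv (w y)) x := by
  simp [pdxx]

/-- Lie reduction 1.1 (subalgebra `⟨P^t + μI⟩`): `u(t,x,y) = e^{μt} w(y,x)` solves
the fine Kolmogorov backward equation iff `w` solves the reduced equation
`z₂ w_1 = z₂² w_22 − μ w`. -/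
theorem stmt_12 (μ : ℝ) (w : ℝ → ℝ → ℝ)
    (hw : ContDiff ℝ (⊤ : ℕ∞) fun q : ℝ × ℝ => w q.1 q.2) :
    IsSolutionOn (fun p : ℝ × ℝ × ℝ => Real.exp (μ * p.1) * w p.2.2 p.2.1) Set.univ ↔
    ∀ z1 z2 : ℝ, z2 * deriv (fun s => w s z2) z1 =
      z2 ^ 2 * deriv (deriv (w z1)) z2 - μ * w z1 z2 := by
  have hu : ContDiff ℝ (⊤ : ℕ∞)
      fun p : ℝ × ℝ × ℝ => Real.exp (μ * p.1) * w p.2.2 p.2.1 := by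
    have hswap : ContDiff ℝ (⊤ : ℕ∞) fun p : ℝ × ℝ × ℝ => (p.2.2, p.2.1) := by fun_prop
    exact (contDiff_const.mul contDiff_fst).exp.mul (hw.comp hswap)
  constructor
  · rintro ⟨-, h⟩ z1 z2
    have h0 := h (0, z2, z1) (mem_univ _)
    rw [pdt_exp_mul, pdy_exp_mul, pdxx_exp_mul] at h0
    simp only [mul_zero, Real.exp_zero, one_mul] at h0
    linarith
  · refine fun h => ⟨hu.contDiffOn, ?_⟩
    rintro ⟨t, x, y⟩ -
    rw [pdt_exp_mul, pdy_exp_mul, pdxx_exp_mul]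
    linear_combination Real.exp (μ * t) * h y x
end

section
/- Let μ ∈ ℝ, ν ≥ 0, and let w : ℝ → ℝ → ℝ be smooth. The function u(t,x,y) := exp(μ·arctan y − x·y/(y² + 1))·w(t − ν·arctan y, x/(y² + 1)) is a solution of the fine Kolmogorov backward equation on all of ℝ³ if and only if w satisfies the reduced equation (1 − ν·z₂)·∂w/∂z₁(z₁,z₂) = z₂²·∂²w/∂z₂²(z₁,z₂) + z₂·(z₂ − μ)·w(z₁,z₂) for all (z₁,z₂) ∈ ℝ². (This is Lie reduction 1.7 of the equation, corresponding to the subalgebra ⟨P^y + K + ν P^t + μ I⟩.) -/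
open Real Set

/-- Chain rule along a curve in the plane, in terms of the two partial derivatives. -/
lemma hasDerivAt_comp_curried {w : ℝ → ℝ → ℝ} {f g : ℝ → ℝ} {f' g' s : ℝ}
    (hw : DifferentiableAt ℝ (fun q : ℝ × ℝ => w q.1 q.2) (f s, g s))
    (hf : HasDerivAt f f' s) (hg : HasDerivAt g g' s) :
    HasDerivAt (fun r => w (f r) (g r))
      (f' * deriv (fun r => w r (g s)) (f s) + g' * deriv (w (f s)) (g s)) s := by
  have h := hw.hasFDerivAt
  set L := fderiv ℝ (fun q : ℝ × ℝ => w q.1 q.2) (f s, g s)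
  have h1 : HasDerivAt (fun r => w r (g s)) (L (1, 0)) (f s) :=
    (h.comp_hasDerivAt (f s) ((hasDerivAt_id (f s)).prodMk (hasDerivAt_const (f s) (g s))) :)
  have h2 : HasDerivAt (w (f s)) (L (0, 1)) (g s) :=
    (h.comp_hasDerivAt (g s) ((hasDerivAt_const (g s) (f s)).prodMk (hasDerivAt_id (g s))) :)
  have h3 : HasDerivAt (fun r => w (f r) (g r)) (L (f', g')) s :=
    (h.comp_hasDerivAt s (hf.prodMk hg) :)
  have hL : L (f', g') = f' * L (1, 0) + g' * L (0, 1) := by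
    rw [← smul_eq_mul, ← smul_eq_mul, ← map_smul, ← map_smul, ← map_add]
    simp
  rwa [h1.deriv, h2.deriv, ← hL]

/-- First `x`-derivative of an exponentially weighted function. -/
lemma hasDerivAt_exp_mul_comp_div {v : ℝ → ℝ} {v' : ℝ} (a b d s : ℝ)
    (hv : HasDerivAt v v' (s / d)) :
    HasDerivAt (fun r => Real.exp (a - r * b / d) * v (r / d))
      (Real.exp (a - s * b / d) * (v' / d - b / d * v (s / d))) s := by
  have hlin : HasDerivAt (fun r : ℝ => r / d) (1 / d) s := (hasDerivAt_id s).div_const d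
  have hexp : HasDerivAt (fun r : ℝ => a - r * b / d) (-(1 * b / d)) s :=
    (((hasDerivAt_id s).mul_const b).div_const d).const_sub a
  have hcomp : HasDerivAt (fun r : ℝ => v (r / d)) (v' * (1 / d)) s := hv.comp s hlin
  refine (hexp.exp.mul hcomp).congr_deriv ?_
  ring

/-- Second `x`-derivative of an exponentially weighted function. -/
lemma deriv_deriv_exp_mul_comp_div {v : ℝ → ℝ} (hv : ContDiff ℝ 2 v) (a b d s : ℝ) :
    deriv (fun x => deriv (fun r => Real.exp (a - r * b / d) * v (r / d)) x) s =
      Real.exp (a - s * b / d) *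
        (deriv (deriv v) (s / d) / d ^ 2 - 2 * b / d ^ 2 * deriv v (s / d) +
          b ^ 2 / d ^ 2 * v (s / d)) := by
  have hd : Differentiable ℝ v := hv.differentiable (by norm_num)
  have hd' : Differentiable ℝ (deriv v) := by
    have h : ContDiff ℝ (1 + 1) v := by simpa [one_add_one_eq_two] using hv
    exact (contDiff_succ_iff_deriv.1 h).2.2.differentiable (by norm_num)
  have hfirst : (fun x => deriv (fun r => Real.exp (a - r * b / d) * v (r / d)) x) =
      fun x => Real.exp (a - x * b / d) * (fun z => deriv v z / d - b / d * v z) (x / d) := by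
    funext x
    exact (hasDerivAt_exp_mul_comp_div a b d x (hd (x / d)).hasDerivAt).deriv
  rw [hfirst]
  have hinner : HasDerivAt (fun z => deriv v z / d - b / d * v z)
      (deriv (deriv v) (s / d) / d - b / d * deriv v (s / d)) (s / d) :=
    ((hd' (s / d)).hasDerivAt.div_const d).sub ((hd (s / d)).hasDerivAt.const_mul (b / d))
  rw [(hasDerivAt_exp_mul_comp_div a b d s hinner).deriv]
  ring

/-- The `y`-derivative of the ansatz. -/
lemma hasDerivAt_ansatz_y (μ ν : ℝ) {w : ℝ → ℝ → ℝ}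
    (hw : Differentiable ℝ fun q : ℝ × ℝ => w q.1 q.2) (t x y : ℝ) :
    HasDerivAt (fun s => Real.exp (μ * Real.arctan s - x * s / (s ^ 2 + 1)) *
        w (t - ν * Real.arctan s) (x / (s ^ 2 + 1)))
      (Real.exp (μ * Real.arctan y - x * y / (y ^ 2 + 1)) *
        ((μ / (y ^ 2 + 1) - x * (1 - y ^ 2) / (y ^ 2 + 1) ^ 2) *
            w (t - ν * Real.arctan y) (x / (y ^ 2 + 1)) -
          ν / (y ^ 2 + 1) *
            deriv (fun r => w r (x / (y ^ 2 + 1))) (t - ν * Real.arctan y) -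
          2 * x * y / (y ^ 2 + 1) ^ 2 *
            deriv (w (t - ν * Real.arctan y)) (x / (y ^ 2 + 1)))) y := by
  have hy : y ^ 2 + 1 ≠ 0 := by positivity
  have hy' : 1 + y ^ 2 ≠ 0 := by positivity
  have harc : HasDerivAt Real.arctan (1 / (1 + y ^ 2)) y := Real.hasDerivAt_arctan y
  have hden : HasDerivAt (fun s : ℝ => s ^ 2 + 1) (2 * y) y := by
    simpa using (hasDerivAt_pow 2 y).add_const 1
  have hquot : HasDerivAt (fun s : ℝ => x / (s ^ 2 + 1)) (-(2 * x * y) / (y ^ 2 + 1) ^ 2) y :=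
    ((hasDerivAt_const y x).div hden hy).congr_deriv (by ring)
  have htime : HasDerivAt (fun s => t - ν * Real.arctan s) (-(ν / (y ^ 2 + 1))) y :=
    ((harc.const_mul ν).const_sub t).congr_deriv (by rw [add_comm (y ^ 2)]; ring)
  have hexp : HasDerivAt (fun s => μ * Real.arctan s - x * s / (s ^ 2 + 1))
      (μ / (y ^ 2 + 1) - x * (1 - y ^ 2) / (y ^ 2 + 1) ^ 2) y :=
    ((harc.const_mul μ).sub (((hasDerivAt_id y).const_mul x).div hden hy)).congr_deriv (by
      simp only [id]
      field_simp
      ring)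
  refine (hexp.exp.mul (hasDerivAt_comp_curried (hw _) htime hquot)).congr_deriv ?_
  ring

/-- The ansatz inherits the smoothness of its profile. -/
lemma contDiff_ansatz (μ ν : ℝ) {w : ℝ → ℝ → ℝ} {n : ℕ∞}
    (hw : ContDiff ℝ n fun q : ℝ × ℝ => w q.1 q.2) :
    ContDiff ℝ n fun p : ℝ × ℝ × ℝ =>
      Real.exp (μ * Real.arctan p.2.2 - p.2.1 * p.2.2 / (p.2.2 ^ 2 + 1)) *
        w (p.1 - ν * Real.arctan p.2.2) (p.2.1 / (p.2.2 ^ 2 + 1)) := by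
  have hy : ContDiff ℝ n fun p : ℝ × ℝ × ℝ => p.2.2 := by fun_prop
  have hx : ContDiff ℝ n fun p : ℝ × ℝ × ℝ => p.2.1 := by fun_prop
  have harc : ContDiff ℝ n fun p : ℝ × ℝ × ℝ => Real.arctan p.2.2 := hy.arctan
  have hden : ContDiff ℝ n fun p : ℝ × ℝ × ℝ => p.2.2 ^ 2 + 1 := by fun_prop
  have hne : ∀ p : ℝ × ℝ × ℝ, p.2.2 ^ 2 + 1 ≠ 0 := fun p => by positivity
  have harg : ContDiff ℝ n fun p : ℝ × ℝ × ℝ =>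
      (p.1 - ν * Real.arctan p.2.2, p.2.1 / (p.2.2 ^ 2 + 1)) :=
    (contDiff_fst.sub (contDiff_const.mul harc)).prodMk (hx.div hden hne)
  exact ((contDiff_const.mul harc).sub ((hx.mul hy).div hden hne)).exp.mul (hw.comp harg)

/-- Lie reduction 1.7 (subalgebra `⟨P^y + K + νP^t + μI⟩`):
`u(t,x,y) = e^{μ arctan y − xy/(y²+1)} w(t − ν arctan y, x/(y²+1))` solves the fine
Kolmogorov backward equation iff `w` solves the reduced equation
`(1 − νz₂) w_1 = z₂² w_22 + z₂(z₂ − μ) w`. -/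
theorem stmt_13 (μ ν : ℝ) (hν : 0 ≤ ν) (w : ℝ → ℝ → ℝ)
    (hw : ContDiff ℝ (⊤ : ℕ∞) fun q : ℝ × ℝ => w q.1 q.2) :
    IsSolutionOn
      (fun p : ℝ × ℝ × ℝ =>
        Real.exp (μ * Real.arctan p.2.2 - p.2.1 * p.2.2 / (p.2.2 ^ 2 + 1)) *
          w (p.1 - ν * Real.arctan p.2.2) (p.2.1 / (p.2.2 ^ 2 + 1)))
      Set.univ ↔
    ∀ z1 z2 : ℝ, (1 - ν * z2) * deriv (fun s => w s z2) z1 =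
      z2 ^ 2 * deriv (deriv (w z1)) z2 + z2 * (z2 - μ) * w z1 z2 := by
  have hwd : Differentiable ℝ fun q : ℝ × ℝ => w q.1 q.2 := hw.differentiable (by simp)
  have hslice : ∀ z, ContDiff ℝ 2 (w z) := fun z =>
    (contDiff_infty.1 hw 2).comp
      ((contDiff_const (c := z)).prodMk contDiff_id)
  have hpt : ∀ t x y : ℝ,
      (pdt (fun p : ℝ × ℝ × ℝ =>
        Real.exp (μ * Real.arctan p.2.2 - p.2.1 * p.2.2 / (p.2.2 ^ 2 + 1)) *
          w (p.1 - ν * Real.arctan p.2.2) (p.2.1 / (p.2.2 ^ 2 + 1))) (t, x, y) +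
        x * pdy (fun p : ℝ × ℝ × ℝ =>
        Real.exp (μ * Real.arctan p.2.2 - p.2.1 * p.2.2 / (p.2.2 ^ 2 + 1)) *
          w (p.1 - ν * Real.arctan p.2.2) (p.2.1 / (p.2.2 ^ 2 + 1))) (t, x, y) =
        x ^ 2 * pdxx (fun p : ℝ × ℝ × ℝ =>
        Real.exp (μ * Real.arctan p.2.2 - p.2.1 * p.2.2 / (p.2.2 ^ 2 + 1)) *
          w (p.1 - ν * Real.arctan p.2.2) (p.2.1 / (p.2.2 ^ 2 + 1))) (t, x, y)) ↔
      (1 - ν * (x / (y ^ 2 + 1))) *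
          deriv (fun s => w s (x / (y ^ 2 + 1))) (t - ν * Real.arctan y) =
        (x / (y ^ 2 + 1)) ^ 2 *
            deriv (deriv (w (t - ν * Real.arctan y))) (x / (y ^ 2 + 1)) +
          x / (y ^ 2 + 1) * (x / (y ^ 2 + 1) - μ) *
            w (t - ν * Real.arctan y) (x / (y ^ 2 + 1)) := by
    intro t x y
    have hy : y ^ 2 + 1 ≠ 0 := by positivity
    simp only [pdt, pdy, pdxx]
    rw [(hasDerivAt_ansatz_y μ ν hwd t x y).deriv, deriv_deriv_exp_mul_comp_div (hslice _),
      deriv_const_mul_field, deriv_comp_sub_const (fun s => w s (x / (y ^ 2 + 1)))]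
    have hE := Real.exp_ne_zero (μ * Real.arctan y - x * y / (y ^ 2 + 1))
    generalize Real.exp (μ * Real.arctan y - x * y / (y ^ 2 + 1)) = E at hE ⊢
    generalize deriv (fun s => w s (x / (y ^ 2 + 1))) (t - ν * Real.arctan y) = w₁
    generalize deriv (deriv (w (t - ν * Real.arctan y))) (x / (y ^ 2 + 1)) = w₂₂
    generalize deriv (w (t - ν * Real.arctan y)) (x / (y ^ 2 + 1)) = w₂
    generalize w (t - ν * Real.arctan y) (x / (y ^ 2 + 1)) = w₀
    rw [← mul_right_inj' hE (b := (1 - ν * (x / (y ^ 2 + 1))) * w₁), ← sub_eq_zero,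
      ← sub_eq_zero (a := E * ((1 - ν * (x / (y ^ 2 + 1))) * w₁))]
    refine Eq.congr_left ?_
    field_simp
    ring
  constructor
  · rintro ⟨-, h⟩ z1 z2
    simpa using (hpt z1 z2 0).1 (h (z1, z2, 0) (Set.mem_univ _))
  · intro h
    exact ⟨(contDiff_ansatz μ ν hw).contDiffOn, fun ⟨t, x, y⟩ _ => (hpt t x y).2 (h _ _)⟩
end

section
/- Fix an integer n ≥ 1, a sign ε ∈ {1, −1}, and a smooth solution θ : ℝ → ℝ → ℝ of the (1+1)-dimensional linear heat equation. For an integer k ≥ 1 let A_k denote the operator sending a smooth function f : ℝ → ℝ → ℝ to the function (z₁,z₂) ↦ 2k·∂f/∂z₂(z₁,z₂) + k²·f(z₁,z₂). For 0 ≤ s ≤ n−1 define w^s : ℝ → ℝ → ℝ by w^s(z₁,z₂) := ε^s·exp((n−s−1)·z₂)·((A_{n−s} ∘ A_{n−s+1} ∘ ⋯ ∘ A_{n−1}) θ)(z₁,z₂), where the composition over the empty index range (s = 0) is the identity, and set w^n := 0. Then for every 0 ≤ s ≤ n−1 one has ∂w^s/∂z₁(z₁,z₂) = ∂²w^s/∂z₂²(z₁,z₂)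 − ε·exp(z₂)·w^{s+1}(z₁,z₂) for all (z₁,z₂) ∈ ℝ². (So these w^s solve the coupled system ℋ_n arising from generalized reduction of the fine Kolmogorov backward equation with respect to the generalized symmetry (D_y^n u)∂_u.) -/
open Real

/-- The operator `A_k` sending `f` to `(z₁,z₂) ↦ 2k ∂f/∂z₂ + k² f`. -/
noncomputable def Aop (k : ℕ) (f : ℝ → ℝ → ℝ) : ℝ → ℝ → ℝ :=
  fun z1 z2 => 2 * (k : ℝ) * deriv (f z1) z2 + (k : ℝ) ^ 2 * f z1 z2

/-- `compA n θ s = (A_{n−s} ∘ A_{n−s+1} ∘ ⋯ ∘ A_{n−1}) θ`, the empty composition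
(`s = 0`) being the identity. -/
noncomputable def compA (n : ℕ) (θ : ℝ → ℝ → ℝ) : ℕ → ℝ → ℝ → ℝ
  | 0 => θ
  | s + 1 => Aop (n - s - 1) (compA n θ s)

/-- `wfam n ε θ s = w^s`, with `w^s(z₁,z₂) = ε^s e^{(n−s−1)z₂} (A_{n−s}⋯A_{n−1}θ)(z₁,z₂)`
for `0 ≤ s ≤ n−1` and `w^s = 0` for `s ≥ n`. -/
noncomputable def wfam (n : ℕ) (ε : ℝ) (θ : ℝ → ℝ → ℝ) (s : ℕ) : ℝ → ℝ → ℝ :=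
  if s < n then
    fun z1 z2 => ε ^ s * Real.exp (((n - s - 1 : ℕ) : ℝ) * z2) * compA n θ s z1 z2
  else fun _ _ => 0

theorem hasDerivAt_partial_fst {F : ℝ → ℝ → ℝ}
    (hF : ContDiff ℝ (⊤ : ℕ∞) fun q : ℝ × ℝ => F q.1 q.2) (a b : ℝ) :
    HasDerivAt (fun r => F r b) (fderiv ℝ (fun q : ℝ × ℝ => F q.1 q.2) (a, b) (1, 0)) a := by
  have h := (hF.differentiable (by simp) (a, b)).hasFDerivAt
  exact h.comp_hasDerivAt a ((hasDerivAt_id a).prodMk (hasDerivAt_const a b))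

theorem hasDerivAt_partial_snd {F : ℝ → ℝ → ℝ}
    (hF : ContDiff ℝ (⊤ : ℕ∞) fun q : ℝ × ℝ => F q.1 q.2) (a b : ℝ) :
    HasDerivAt (F a) (fderiv ℝ (fun q : ℝ × ℝ => F q.1 q.2) (a, b) (0, 1)) b := by
  have h := (hF.differentiable (by simp) (a, b)).hasFDerivAt
  exact h.comp_hasDerivAt b ((hasDerivAt_const b a).prodMk (hasDerivAt_id b))

theorem contDiff_fderiv_apply_const {G : ℝ × ℝ → ℝ} (hG : ContDiff ℝ (⊤ : ℕ∞) G) (v : ℝ × ℝ) :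
    ContDiff ℝ (⊤ : ℕ∞) fun q => fderiv ℝ G q v :=
  (hG.fderiv_right (m := (⊤ : ℕ∞)) (by simp)).clm_apply contDiff_const

theorem contDiff_partial_snd {F : ℝ → ℝ → ℝ}
    (hF : ContDiff ℝ (⊤ : ℕ∞) fun q : ℝ × ℝ => F q.1 q.2) :
    ContDiff ℝ (⊤ : ℕ∞) fun q : ℝ × ℝ => deriv (F q.1) q.2 := by
  simpa only [(hasDerivAt_partial_snd hF _ _).deriv] using contDiff_fderiv_apply_const hF (0, 1)

theorem deriv_partial_comm {F : ℝ → ℝ → ℝ}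
    (hF : ContDiff ℝ (⊤ : ℕ∞) fun q : ℝ × ℝ => F q.1 q.2) (a b : ℝ) :
    deriv (fun r => deriv (F r) b) a = deriv (fun y => deriv (fun r => F r y) a) b := by
  simp only [(hasDerivAt_partial_snd hF _ _).deriv, (hasDerivAt_partial_fst hF _ _).deriv]
  have hd : DifferentiableAt ℝ (fderiv ℝ fun q : ℝ × ℝ => F q.1 q.2) (a, b) :=
    (hF.fderiv_right (m := (⊤ : ℕ∞)) (by simp)).differentiable (by simp) (a, b)
  have hsymm : IsSymmSndFDerivAt ℝ (fun q : ℝ × ℝ => F q.1 q.2) (a, b) :=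
    hF.contDiffAt.isSymmSndFDerivAt
      (by simpa using WithTop.coe_le_coe.2 (le_top : (2 : ℕ∞) ≤ ⊤))
  have h1 := (hasDerivAt_partial_fst
    (F := fun x y => fderiv ℝ (fun q : ℝ × ℝ => F q.1 q.2) (x, y) (0, 1))
    (contDiff_fderiv_apply_const hF (0, 1)) a b).deriv
  have h2 := (hasDerivAt_partial_snd
    (F := fun x y => fderiv ℝ (fun q : ℝ × ℝ => F q.1 q.2) (x, y) (1, 0))
    (contDiff_fderiv_apply_const hF (1, 0)) a b).deriv
  rw [h1, h2]
  simp only [Prod.mk.eta]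
  rw [fderiv_clm_apply hd (by fun_prop), fderiv_clm_apply hd (by fun_prop)]
  simpa using hsymm (1, 0) (0, 1)

theorem contDiff_Aop {F : ℝ → ℝ → ℝ}
    (hF : ContDiff ℝ (⊤ : ℕ∞) fun q : ℝ × ℝ => F q.1 q.2) (k : ℕ) :
    ContDiff ℝ (⊤ : ℕ∞) fun q : ℝ × ℝ => Aop k F q.1 q.2 :=
  (contDiff_const.mul (contDiff_partial_snd hF)).add (contDiff_const.mul hF)

theorem Aop_heat {F : ℝ → ℝ → ℝ}
    (hF : ContDiff ℝ (⊤ : ℕ∞) fun q : ℝ × ℝ => F q.1 q.2)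
    (hheat : ∀ a b : ℝ, deriv (fun r => F r b) a = deriv (deriv (F a)) b) (k : ℕ) (a b : ℝ) :
    deriv (fun r => Aop k F r b) a = deriv (deriv (Aop k F a)) b := by
  have hF' := contDiff_partial_snd hF
  have hF'' := contDiff_partial_snd (F := fun x => deriv (F x)) hF'
  have d0 (y : ℝ) := (hasDerivAt_partial_snd hF a y).differentiableAt.hasDerivAt
  have d1 (y : ℝ) := (hasDerivAt_partial_snd (F := fun x => deriv (F x)) hF' a
    y).differentiableAt.hasDerivAt
  have d2 (y : ℝ) := (hasDerivAt_partial_snd (F := fun x => deriv (deriv (F x))) hF'' a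
    y).differentiableAt.hasDerivAt
  have e0 := (hasDerivAt_partial_fst hF a b).differentiableAt.hasDerivAt
  have e1 := (hasDerivAt_partial_fst (F := fun x => deriv (F x)) hF' a
    b).differentiableAt.hasDerivAt
  have hA : deriv (Aop k F a) = fun y =>
      2 * (k : ℝ) * deriv (deriv (F a)) y + (k : ℝ) ^ 2 * deriv (F a) y :=
    funext fun y => (((d1 y).const_mul _).add ((d0 y).const_mul _)).deriv
  have hR := (((d2 b).const_mul (2 * (k : ℝ))).add ((d1 b).const_mul ((k : ℝ) ^ 2))).deriv
  have hL := ((e1.const_mul (2 * (k : ℝ))).add (e0.const_mul ((k : ℝ) ^ 2))).deriv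
  have hc := deriv_partial_comm hF a b
  simp only [hheat] at hc
  rw [hA]
  refine hL.trans (Eq.trans ?_ hR.symm)
  rw [hheat, hc]

theorem compA_contDiff_and_heat (n : ℕ) {θ : ℝ → ℝ → ℝ}
    (hθ : ContDiff ℝ (⊤ : ℕ∞) fun q : ℝ × ℝ => θ q.1 q.2)
    (hheat : ∀ a b : ℝ, deriv (fun r => θ r b) a = deriv (deriv (θ a)) b) (s : ℕ) :
    (ContDiff ℝ (⊤ : ℕ∞) fun q : ℝ × ℝ => compA n θ s q.1 q.2) ∧
      ∀ a b : ℝ, deriv (fun r => compA n θ s r b) a = deriv (deriv (compA n θ s a)) b := by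
  induction s with
  | zero => exact ⟨hθ, hheat⟩
  | succ s ih => exact ⟨contDiff_Aop ih.1 _, Aop_heat ih.1 ih.2 _⟩

theorem deriv_deriv_exp_mul {F : ℝ → ℝ → ℝ}
    (hF : ContDiff ℝ (⊤ : ℕ∞) fun q : ℝ × ℝ => F q.1 q.2) (c : ℝ) (k : ℕ) (a b : ℝ) :
    deriv (deriv fun y => c * Real.exp (k * y) * F a y) b =
      c * Real.exp (k * b) * (deriv (deriv (F a)) b + Aop k F a b) := by
  have d0 (y : ℝ) := (hasDerivAt_partial_snd hF a y).differentiableAt.hasDerivAt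
  have d1 (y : ℝ) := (hasDerivAt_partial_snd (F := fun x => deriv (F x))
    (contDiff_partial_snd hF) a y).differentiableAt.hasDerivAt
  have dE (y : ℝ) : HasDerivAt (fun y : ℝ => c * Real.exp (k * y))
      (c * (Real.exp (k * y) * (k * 1))) y :=
    (((hasDerivAt_id y).const_mul (k : ℝ)).exp).const_mul c
  have h1 : (deriv fun y => c * Real.exp (k * y) * F a y) =
      fun y => c * Real.exp (k * y) * (k * F a y + deriv (F a) y) := by
    funext y
    rw [((dE y).fun_mul (d0 y)).deriv]
    ring
  rw [h1, ((dE b).fun_mul (((d0 b).const_mul (k : ℝ)).fun_add (d1 b))).deriv, Aop]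
  ring

/-- The functions `w^s` solve the coupled system `ℋ_n`:
`w^s_1 = w^s_22 − ε e^{z₂} w^{s+1}` for `0 ≤ s ≤ n−1` (with `w^n = 0`). -/
theorem stmt_14 (n : ℕ) (hn : 1 ≤ n) (ε : ℝ) (hε : ε = 1 ∨ ε = -1)
    (θ : ℝ → ℝ → ℝ)
    (hθ : ContDiff ℝ (⊤ : ℕ∞) fun q : ℝ × ℝ => θ q.1 q.2)
    (hheat : ∀ z1 z2 : ℝ, deriv (fun s => θ s z2) z1 = deriv (deriv (θ z1)) z2) :
    ∀ s : ℕ, s ≤ n - 1 → ∀ z1 z2 : ℝ,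
      deriv (fun r => wfam n ε θ s r z2) z1 =
        deriv (deriv (wfam n ε θ s z1)) z2 - ε * Real.exp z2 * wfam n ε θ (s + 1) z1 z2 := by
  intro s hs z1 z2
  have hsn : s < n := by omega
  obtain ⟨hF, hFheat⟩ := compA_contDiff_and_heat n hθ hheat s
  have hw : wfam n ε θ s = fun z1 z2 =>
      ε ^ s * Real.exp (((n - s - 1 : ℕ) : ℝ) * z2) * compA n θ s z1 z2 := if_pos hsn
  have hcoupling : ε * Real.exp z2 * wfam n ε θ (s + 1) z1 z2 =
      ε ^ s * Real.exp (((n - s - 1 : ℕ) : ℝ) * z2) * Aop (n - s - 1) (compA n θ s) z1 z2 := by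
    by_cases hlt : s + 1 < n
    · obtain ⟨m, hm⟩ : ∃ m, n - s - 1 = m + 1 := ⟨n - s - 2, by omega⟩
      have hm' : n - (s + 1) - 1 = m := by omega
      have hε2 : ε ^ 2 = 1 := by rcases hε with rfl | rfl <;> norm_num
      have hexp : Real.exp (((m + 1 : ℕ) : ℝ) * z2) = Real.exp z2 * Real.exp (m * z2) := by
        rw [← Real.exp_add]
        push_cast
        ring_nf
      rw [wfam, if_pos hlt, compA, hm', hm, hexp]
      linear_combination ε ^ s * Real.exp z2 * Real.exp (m * z2) *
        Aop (m + 1) (compA n θ s) z1 z2 * hε2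
    · have hm : n - s - 1 = 0 := by omega
      simp [wfam, hlt, hm, Aop]
  rw [hcoupling, hw, deriv_deriv_exp_mul hF, deriv_const_mul _
    (hasDerivAt_partial_fst hF z1 z2).differentiableAt, hFheat]
  ring
end

section
/- Fix an integer n ≥ 1 and a smooth solution θ : ℝ → ℝ → ℝ of the (1+1)-dimensional linear heat equation. Let 𝒦 be the Lie-symmetry operator sending a smooth function v on Ω := {(t,x,y) ∈ ℝ³ : x > 0} to the function (t,x,y) ↦ 2xy·∂v/∂x + y²·∂v/∂y + x·v. Let A_k (k ≥ 1) send a smooth f : ℝ → ℝ → ℝ to (z₁,z₂) ↦ 2k·∂f/∂z₂ + k²·f, and set φ_s := (A_{n−s} ∘ ⋯ ∘ A_{n−1}) θ for 0 ≤ s ≤ n−1 (empty composition = identity). Then the (n−1)-fold iterate of 𝒦 applied to the function u₀(t,x,y) := exp(−t/4)·x^{1/2}·θ(t, ln x) coincides on Ω with the function (t,x,y) ↦ exp(−t/4)·x^{n−1/2}·Σ_{s=0}^{n−1} (y^s·x^{−s}/s!)·φ_s(t, ln x). (That is, the solutions obtained by generalized reduction with respect to (D_y^n u)∂_u are exactly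 the iterated images 𝒦^{n−1} of the ⟨P^y⟩-invariant solutions.) -/
open Real Set

/-- The Lie-symmetry operator `𝒦 = 2xy D_x + y² D_y + x` acting on functions on `ℝ³`. -/
noncomputable def Kop (v : ℝ × ℝ × ℝ → ℝ) : ℝ × ℝ × ℝ → ℝ :=
  fun p => 2 * p.2.1 * p.2.2 * pdx v p + p.2.2 ^ 2 * pdy v p + p.2.1 * v p

theorem contDiff_Aop_s16 {f : ℝ → ℝ → ℝ} (hf : ∀ z, ContDiff ℝ (⊤ : ℕ∞) (f z)) (k : ℕ) (z : ℝ) :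
    ContDiff ℝ (⊤ : ℕ∞) (Aop k f z) := by
  have hd : ContDiff ℝ (⊤ : ℕ∞) (deriv (f z)) := (contDiff_infty_iff_deriv.1 (hf z)).2
  exact (contDiff_const.mul hd).add (contDiff_const.mul (hf z))

theorem contDiff_compA {f : ℝ → ℝ → ℝ} (hf : ∀ z, ContDiff ℝ (⊤ : ℕ∞) (f z)) (n s : ℕ) :
    ∀ z, ContDiff ℝ (⊤ : ℕ∞) (compA n f s z) := by
  induction s with
  | zero => exact hf
  | succ s ih => exact contDiff_Aop_s16 ih _

theorem deriv_Aop {f : ℝ → ℝ → ℝ} (hf : ∀ z, ContDiff ℝ (⊤ : ℕ∞) (f z)) (k : ℕ) (z w : ℝ) :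
    deriv (Aop k f z) w = 2 * (k : ℝ) * deriv (deriv (f z)) w + (k : ℝ) ^ 2 * deriv (f z) w := by
  have hd : ContDiff ℝ (⊤ : ℕ∞) (deriv (f z)) := (contDiff_infty_iff_deriv.1 (hf z)).2
  have h₁ : HasDerivAt (deriv (f z)) _ w := (hd.differentiable (by simp) w).hasDerivAt
  have h₂ : HasDerivAt (f z) _ w := ((hf z).differentiable (by simp) w).hasDerivAt
  exact ((h₁.const_mul _).add (h₂.const_mul _)).deriv

theorem Aop_comm {f : ℝ → ℝ → ℝ} (hf : ∀ z, ContDiff ℝ (⊤ : ℕ∞) (f z)) (j k : ℕ) :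
    Aop j (Aop k f) = Aop k (Aop j f) := by
  funext z w
  change 2 * (j : ℝ) * deriv (Aop k f z) w + (j : ℝ) ^ 2 * Aop k f z w =
    2 * (k : ℝ) * deriv (Aop j f z) w + (k : ℝ) ^ 2 * Aop j f z w
  rw [deriv_Aop hf, deriv_Aop hf]
  simp only [Aop]
  ring

theorem compA_succ_succ (n : ℕ) (f : ℝ → ℝ → ℝ) (s : ℕ) :
    compA (n + 1) f (s + 1) = compA n (Aop n f) s := by
  induction s with
  | zero => simp [compA]
  | succ s ih =>
    rw [compA, ih, compA]
    congr 1
    omega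

theorem compA_Aop {f : ℝ → ℝ → ℝ} (hf : ∀ z, ContDiff ℝ (⊤ : ℕ∞) (f z)) (n k s : ℕ) :
    compA n (Aop k f) s = Aop k (compA n f s) := by
  induction s with
  | zero => rfl
  | succ s ih => rw [compA, ih, Aop_comm (contDiff_compA hf n s), compA]

theorem compA_self (n : ℕ) (f : ℝ → ℝ → ℝ) (z w : ℝ) : compA (n + 1) f (n + 1) z w = 0 := by
  simp [compA, Aop]

/-- The recursion in `n` of the coefficients `compA n f s`. -/
theorem compA_succ_recursion {f : ℝ → ℝ → ℝ} (hf : ∀ z, ContDiff ℝ (⊤ : ℕ∞) (f z))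
    {n s : ℕ} (hs : s < n) (z w : ℝ) :
    compA (n + 1) f (s + 1) z w = compA n f (s + 1) z w +
      (s + 1) * ((2 * n - s - 1) * compA n f s z w + 2 * deriv (compA n f s z) w) := by
  rw [compA_succ_succ, compA_Aop hf, compA]
  simp only [Aop]
  rw [Nat.sub_sub, Nat.cast_sub (by omega : s + 1 ≤ n)]
  push_cast
  ring

/-- The polynomial in `y / x` with coefficients `compA n f s t (log x) / s!` for `s < n`. -/
noncomputable def reducedSum (n : ℕ) (f : ℝ → ℝ → ℝ) (t x y : ℝ) : ℝ :=
  ∑ s ∈ Finset.range n, (y / x) ^ s / (Nat.factorial s : ℝ) * compA n f s t (Real.log x)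

theorem reducedSum_succ {f : ℝ → ℝ → ℝ} (hf : ∀ z, ContDiff ℝ (⊤ : ℕ∞) (f z))
    {n : ℕ} (hn : 1 ≤ n) (t x y : ℝ) :
    reducedSum (n + 1) f t x y = reducedSum n f t x y +
      (y / x) * ∑ s ∈ Finset.range n, (y / x) ^ s / (Nat.factorial s : ℝ) *
        ((2 * n - s - 1) * compA n f s t (Real.log x) +
          2 * deriv (compA n f s t) (Real.log x)) := by
  obtain ⟨m, rfl⟩ := Nat.exists_eq_add_of_le' hn
  have hlast : reducedSum (m + 1) f t x y = ∑ s ∈ Finset.range (m + 1 + 1),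
      (y / x) ^ s / (Nat.factorial s : ℝ) * compA (m + 1) f s t (Real.log x) := by
    rw [Finset.sum_range_succ, compA_self, mul_zero, add_zero, reducedSum]
  rw [hlast, reducedSum, Finset.sum_range_succ' _ (m + 1), Finset.sum_range_succ' _ (m + 1),
    add_right_comm (Finset.sum _ _), Finset.mul_sum, ← Finset.sum_add_distrib]
  refine congrArg₂ _ ?_ rfl
  refine Finset.sum_congr rfl fun s hs => ?_
  rw [compA_succ_recursion hf (Finset.mem_range.1 hs), Nat.factorial_succ]
  have : (s.factorial : ℝ) ≠ 0 := by positivity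
  push_cast
  field_simp
  ring

theorem hasDerivAt_reducedSum_x {f : ℝ → ℝ → ℝ} (hf : ∀ z, ContDiff ℝ (⊤ : ℕ∞) (f z))
    (n : ℕ) (t y : ℝ) {x : ℝ} (hx : x ≠ 0) :
    HasDerivAt (fun r => reducedSum n f t r y)
      (∑ s ∈ Finset.range n, (y / x) ^ s / (Nat.factorial s : ℝ) *
        (deriv (compA n f s t) (Real.log x) - s * compA n f s t (Real.log x)) / x) x := by
  refine HasDerivAt.fun_sum fun s _ => ?_
  have hc : HasDerivAt (compA n f s t) _ (Real.log x) :=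
    ((contDiff_compA hf n s t).differentiable (by simp) _).hasDerivAt
  have hq : HasDerivAt (fun r => y / r) (-y / x ^ 2) x := by
    simpa using (hasDerivAt_const x y).fun_div (hasDerivAt_id' x) hx
  refine (((hq.fun_pow s).div_const _).mul (hc.comp x (Real.hasDerivAt_log hx))).congr_deriv ?_
  rcases s with _ | s
  · simp [div_eq_mul_inv]
  · simp only [Nat.add_sub_cancel, Function.comp_apply, div_pow]
    field_simp
    ring

theorem hasDerivAt_reducedSum_y (f : ℝ → ℝ → ℝ) (n : ℕ) (t x y : ℝ) :
    HasDerivAt (fun r => reducedSum n f t x r)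
      (∑ s ∈ Finset.range n, s * (y / x) ^ (s - 1) / x / (Nat.factorial s : ℝ) *
        compA n f s t (Real.log x)) y := by
  refine HasDerivAt.fun_sum fun s _ => ?_
  refine ((((hasDerivAt_id' y).div_const x).fun_pow s).div_const _ |>.mul_const _).congr_deriv ?_
  ring

theorem Kop_congr {v w : ℝ × ℝ × ℝ → ℝ} (h : ∀ p : ℝ × ℝ × ℝ, 0 < p.2.1 → v p = w p)
    {p : ℝ × ℝ × ℝ} (hp : 0 < p.2.1) : Kop v p = Kop w p := by
  have hx : pdx v p = pdx w p := by
    refine Filter.EventuallyEq.deriv_eq ?_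
    filter_upwards [lt_mem_nhds hp] with s hs using h _ hs
  have hy : pdy v p = pdy w p := by
    unfold pdy
    congr 1
    funext s
    exact h _ hp
  rw [Kop, Kop, hx, hy, h p hp]

theorem Kop_reducedSum {f : ℝ → ℝ → ℝ} (hf : ∀ z, ContDiff ℝ (⊤ : ℕ∞) (f z))
    {n : ℕ} (hn : 1 ≤ n) {p : ℝ × ℝ × ℝ} (hp : 0 < p.2.1) :
    Kop (fun q => Real.exp (-q.1 / 4) * q.2.1 ^ ((n : ℝ) - 1 / 2) *
      reducedSum n f q.1 q.2.1 q.2.2) p =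
    Real.exp (-p.1 / 4) * p.2.1 ^ (((n + 1 : ℕ) : ℝ) - 1 / 2) *
      reducedSum (n + 1) f p.1 p.2.1 p.2.2 := by
  obtain ⟨t, x, y⟩ := p
  replace hp : 0 < x := hp
  have hx := (((Real.hasDerivAt_rpow_const (p := (n : ℝ) - 1 / 2) (Or.inl hp.ne')).const_mul
    (Real.exp (-t / 4))).fun_mul (hasDerivAt_reducedSum_x hf n t y hp.ne')).deriv
  have hy := ((hasDerivAt_reducedSum_y f n t x y).const_mul
    (Real.exp (-t / 4) * x ^ ((n : ℝ) - 1 / 2))).deriv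
  have hpow : x ^ (((n + 1 : ℕ) : ℝ) - 1 / 2) = x ^ ((n : ℝ) - 1 / 2) * x := by
    rw [← Real.rpow_add_one hp.ne']
    congr 1
    push_cast
    ring
  have hsum : 2 * (y / x) * (((n : ℝ) - 1 / 2) * reducedSum n f t x y +
        x * ∑ s ∈ Finset.range n, (y / x) ^ s / (Nat.factorial s : ℝ) *
          (deriv (compA n f s t) (Real.log x) - s * compA n f s t (Real.log x)) / x) +
      y ^ 2 / x * ∑ s ∈ Finset.range n, s * (y / x) ^ (s - 1) / x / (Nat.factorial s : ℝ) *
        compA n f s t (Real.log x) =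
      (y / x) * ∑ s ∈ Finset.range n, (y / x) ^ s / (Nat.factorial s : ℝ) *
        ((2 * n - s - 1) * compA n f s t (Real.log x) +
          2 * deriv (compA n f s t) (Real.log x)) := by
    simp only [reducedSum, Finset.mul_sum, ← Finset.sum_add_distrib]
    refine Finset.sum_congr rfl fun s _ => ?_
    rcases s with _ | s
    · simp
      field_simp
    · simp only [Nat.add_sub_cancel, div_pow]
      push_cast
      field_simp
      ring
  simp only [Kop, pdx, pdy]
  rw [hx, hy, reducedSum_succ hf hn, ← hsum, hpow, Real.rpow_sub_one hp.ne']
  field_simp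
  ring

theorem iterate_Kop_eq {f : ℝ → ℝ → ℝ} (hf : ∀ z, ContDiff ℝ (⊤ : ℕ∞) (f z)) (m : ℕ) :
    ∀ p : ℝ × ℝ × ℝ, 0 < p.2.1 →
      (Kop^[m] (fun p : ℝ × ℝ × ℝ =>
          Real.exp (-p.1 / 4) * p.2.1 ^ ((1 : ℝ) / 2) * f p.1 (Real.log p.2.1))) p =
      Real.exp (-p.1 / 4) * p.2.1 ^ (((m + 1 : ℕ) : ℝ) - 1 / 2) *
        reducedSum (m + 1) f p.1 p.2.1 p.2.2 := by
  induction m with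
  | zero =>
    intro p _
    norm_num [reducedSum, compA]
  | succ m ih =>
    intro p hp
    rw [Function.iterate_succ_apply', Kop_congr ih hp, Kop_reducedSum hf (by omega) hp]

/-- The `(n−1)`-fold iterate of the Lie-symmetry operator `𝒦` applied to the
`⟨P^y⟩`-invariant solution `u₀(t,x,y) = e^{-t/4} x^{1/2} θ(t, ln x)` coincides on
`{x > 0}` with the solution obtained by generalized reduction with respect to
`(D_y^n u)∂_u`. -/
theorem stmt_16 (n : ℕ) (hn : 1 ≤ n) (θ : ℝ → ℝ → ℝ)
    (hθ : ContDiff ℝ (⊤ : ℕ∞) fun q : ℝ × ℝ => θ q.1 q.2)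
    (hheat : ∀ z1 z2 : ℝ, deriv (fun s => θ s z2) z1 = deriv (deriv (θ z1)) z2) :
    ∀ p : ℝ × ℝ × ℝ, 0 < p.2.1 →
      (Kop^[n - 1]
        (fun p : ℝ × ℝ × ℝ =>
          Real.exp (-p.1 / 4) * p.2.1 ^ ((1 : ℝ) / 2) * θ p.1 (Real.log p.2.1))) p =
      Real.exp (-p.1 / 4) * p.2.1 ^ ((n : ℝ) - 1 / 2) *
        ∑ s ∈ Finset.range n,
          p.2.2 ^ s * p.2.1 ^ (-(s : ℤ)) / (Nat.factorial s : ℝ) *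
            compA n θ s p.1 (Real.log p.2.1) := by
  have hf : ∀ z, ContDiff ℝ (⊤ : ℕ∞) (θ z) := fun z =>
    hθ.comp (contDiff_const.prodMk contDiff_id)
  obtain ⟨m, rfl⟩ := Nat.exists_eq_add_of_le' hn
  intro p hp
  rw [Nat.add_sub_cancel, iterate_Kop_eq hf m p hp, reducedSum]
  simp only [zpow_neg, zpow_natCast, div_eq_mul_inv, mul_pow, inv_pow]
end
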